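/- arXiv:1009.1751 — 3 statements merged into one kernel-verified Lean document; each statement's English description precedes it below -/
import Mathlib

section
/- Let 0<p<∞. Then there is a positive real number C_p depending only on p such that σ_0^{p,∞}(ρ_p) = ∫_{Δ_p^n} max_{1≤j≤n} x_j dρ_p(x) ≤ C_p · (log(n+1)/n)^{1/p} for all n ≥ 2. -/
open MeasureTheory Real Set
open scoped ENNReal

noncomputable section

/-- The `m`-th largest value among `|x_1|, …, |x_n|` (for `1 ≤ m ≤ n`). -/
def kthMax {ι : Type*} [Fintype ι] (x : ι → ℝ) (m : ℕ) : ℝ :=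
  sSup {t : ℝ | ∃ S : Finset ι, m ≤ S.card ∧ ∀ j ∈ S, t ≤ |x j|}

/-- The positive part `Δ_p^n` of the unit sphere of `ℓ_p^n`, inside Euclidean space. -/
def DeltaE (p : ℝ) (n : ℕ) : Set (EuclideanSpace ℝ (Fin n)) :=
  {t | (∀ i, 0 ≤ t i) ∧ ∑ i, t i ^ p = 1}

/-- The cone `[0,1] · A = {t • a : t ∈ [0,1], a ∈ A}`. -/
def coneE {n : ℕ} (A : Set (EuclideanSpace ℝ (Fin n))) : Set (EuclideanSpace ℝ (Fin n)) :=
  {x | ∃ t ∈ Icc (0 : ℝ) 1, ∃ a ∈ A, x = t • a}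

/-- `μ` is the normalized cone measure on `Δ_p^n`: it is a Borel probability measure with
`μ(A) = λ([0,1]·A) / λ([0,1]·Δ_p^n)` for every Borel `A ⊆ Δ_p^n`. -/
def IsConeMeasureE (p : ℝ) (n : ℕ) (μ : Measure (EuclideanSpace ℝ (Fin n))) : Prop :=
  IsProbabilityMeasure μ ∧
    ∀ A : Set (EuclideanSpace ℝ (Fin n)), MeasurableSet A → A ⊆ DeltaE p n →
      μ A = volume (coneE A) / volume (coneE (DeltaE p n))

/-- `ρ` is the normalized surface measure on `Δ_p^n`: the `(n-1)`-dimensional Hausdorff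
measure restricted to `Δ_p^n` and normalized, `ρ(A) = H^{n-1}(A ∩ Δ_p^n)/H^{n-1}(Δ_p^n)`. -/
def IsSurfaceMeasureE (p : ℝ) (n : ℕ) (ρ : Measure (EuclideanSpace ℝ (Fin n))) : Prop :=
  ρ = (μH[(n : ℝ) - 1] (DeltaE p n))⁻¹ • (μH[(n : ℝ) - 1]).restrict (DeltaE p n)

/-- A set of finite diameter `T` can be cut into `2N+1` slices along `f`, so that the preimages
of the slices under `G` have small diameter. -/
lemma slice_cover {X Y : Type*} [MetricSpace X] [MetricSpace Y]
    (A : Set X) (G : X → Y) (f : Y → ℝ) (hf : ∀ y y', |f y - f y'| ≤ dist y y')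
    (c M : ℝ) (hc : 0 < c) (hM : 0 ≤ M)
    (h : ∀ a ∈ A, ∀ a' ∈ A, dist a a' ≤ c * dist (G a) (G a') + M * |f (G a) - f (G a')|)
    (N : ℕ) (hN : 0 < N) (T : Set Y) (hT : Metric.ediam T ≠ ∞) :
    ∃ u : Fin (2 * N + 1) → Set X, A ∩ G ⁻¹' T ⊆ ⋃ k, u k ∧
      ∀ k, Metric.ediam (u k) ≤ ENNReal.ofReal (c + M / N) * Metric.ediam T := by
  rcases T.eq_empty_or_nonempty with rfl | ⟨y0, hy0⟩
  · exact ⟨fun _ => ∅, by simp⟩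
  have hNr : (0 : ℝ) < N := by exact_mod_cast hN
  set D : ℝ := (Metric.ediam T).toReal with hD
  have hDT : ∀ y ∈ T, ∀ y' ∈ T, dist y y' ≤ D := by
    intro y hy y' hy'
    rw [dist_edist]
    exact ENNReal.toReal_mono hT (Metric.edist_le_ediam_of_mem hy hy')
  have hD0 : 0 ≤ D := ENNReal.toReal_nonneg
  let v : Y → ℝ := fun y => (f y - f y0 + D) * N / D
  refine ⟨fun k => {a | a ∈ A ∧ G a ∈ T ∧ ⌊v (G a)⌋₊ = k.1}, ?_, ?_⟩
  · rintro a ⟨haA, haT⟩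
    have hv : v (G a) ≤ 2 * N := by
      simp only [v]
      rcases hD0.eq_or_lt with h0 | h0
      · rw [← h0]; simp
      · rw [div_le_iff₀ h0]
        have h1 := (abs_le.1 ((hf (G a) y0).trans (hDT _ haT _ hy0))).2
        nlinarith
    have : ⌊v (G a)⌋₊ < 2 * N + 1 := by
      have := Nat.floor_mono hv
      have h2 : ⌊(2 * N : ℝ)⌋₊ = 2 * N := by
        have : (2 * N : ℝ) = ((2 * N : ℕ) : ℝ) := by push_cast; ring
        rw [this, Nat.floor_natCast]
      omega
    exact mem_iUnion.2 ⟨⟨_, this⟩, haA, haT, rfl⟩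
  · intro k
    have key : ∀ a, a ∈ A → G a ∈ T → 0 ≤ v (G a) := by
      intro a _ haT
      have h1 := (abs_le.1 ((hf (G a) y0).trans (hDT _ haT _ hy0))).1
      have : 0 ≤ f (G a) - f y0 + D := by linarith
      simp only [v]; positivity
    refine Metric.ediam_le ?_
    rintro a ⟨haA, haT, hak⟩ b ⟨hbA, hbT, hbk⟩
    have hfd : |f (G a) - f (G b)| ≤ D / N := by
      rcases hD0.eq_or_lt with h0 | h0
      · have := (hf (G a) (G b)).trans (hDT _ haT _ hbT)
        rw [← h0] at this ⊢; simpa using this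
      · have a1 := Nat.floor_le (key a haA haT)
        have a2 := Nat.lt_floor_add_one (v (G a))
        have b1 := Nat.floor_le (key b hbA hbT)
        have b2 := Nat.lt_floor_add_one (v (G b))
        rw [hak] at a1 a2
        rw [hbk] at b1 b2
        have hab : f (G a) - f (G b) = (v (G a) - v (G b)) * (D / N) := by
          simp only [v]; field_simp; ring
        have hv1 : |v (G a) - v (G b)| ≤ 1 := abs_le.2 ⟨by linarith, by linarith⟩
        rw [hab, abs_mul, abs_of_nonneg (by positivity : 0 ≤ D / N)]
        have : 0 ≤ D / N := by positivity
        nlinarith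
    have : dist a b ≤ (c + M / N) * D := by
      calc dist a b ≤ _ := h a haA b hbA
        _ ≤ c * D + M * (D / N) := by
          gcongr
          exact hDT _ haT _ hbT
        _ = _ := by ring
    rw [edist_dist, ← ENNReal.ofReal_toReal hT, ← ENNReal.ofReal_mul (by positivity)]
    exact ENNReal.ofReal_le_ofReal this

open Filter Topology in
lemma hausdorff_slice {X Y : Type*} [MetricSpace X] [MetricSpace Y]
    [MeasurableSpace X] [BorelSpace X] [MeasurableSpace Y] [BorelSpace Y]
    (A : Set X) (S : Set Y) (G : X → Y) (hG : MapsTo G A S)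
    (f : Y → ℝ) (hf : ∀ y y', |f y - f y'| ≤ dist y y')
    (c M : ℝ) (hc : 0 < c) (hM : 0 ≤ M)
    (h : ∀ a ∈ A, ∀ a' ∈ A, dist a a' ≤ c * dist (G a) (G a') + M * |f (G a) - f (G a')|)
    (N : ℕ) (hN : 0 < N) (d : ℝ) (hd : 0 < d) :
    μH[d] A ≤ ((2 * N + 1 : ℕ) : ℝ≥0∞) * ENNReal.ofReal (c + M / N) ^ d * μH[d] S := by
  set L : ℝ≥0∞ := ENNReal.ofReal (c + M / N) with hL
  have hL0 : L ≠ 0 := by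
    rw [hL]; simp only [ne_eq, ENNReal.ofReal_eq_zero, not_le]; positivity
  have hLt : L ≠ ∞ := ENNReal.ofReal_ne_top
  set Q : ℝ≥0∞ := ((2 * N + 1 : ℕ) : ℝ≥0∞) * L ^ d with hQ
  have hQ0 : Q ≠ 0 := by
    rw [hQ]
    refine mul_ne_zero (by simp) ?_
    simp [hd, hd.not_gt, hL0, hLt]
  have hQt : Q ≠ ∞ := ENNReal.mul_ne_top (ENNReal.natCast_ne_top _) (ENNReal.rpow_ne_top_of_nonneg hd.le hLt)
  by_cases hS : μH[d] S = ∞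
  · rw [hS, ENNReal.mul_top hQ0]; exact le_top
  -- covers
  let e : ℕ → ℝ≥0∞ := fun k => ((k : ℝ≥0∞))⁻¹
  have he0 : ∀ k, 0 < e k := fun k => by simp [e]
  have hcov : ∀ k : ℕ, ∃ t : ℕ → Set Y, S ⊆ ⋃ n, t n ∧ (∀ n, Metric.ediam (t n) ≤ e (k + 1)) ∧
      ∑' n, Metric.ediam (t n) ^ d ≤ μH[d] S + e (k + 1) := by
    intro k
    have h1 : (⨅ (t : ℕ → Set Y) (_ : S ⊆ ⋃ n, t n) (_ : ∀ n, Metric.ediam (t n) ≤ e (k + 1)),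
          ∑' n, ⨆ _ : (t n).Nonempty, Metric.ediam (t n) ^ d) < μH[d] S + e (k + 1) := by
      refine lt_of_le_of_lt ?_ (ENNReal.lt_add_right hS (he0 (k + 1)).ne')
      rw [Measure.hausdorffMeasure_apply]
      exact le_iSup₂ (f := fun (r : ℝ≥0∞) (_ : 0 < r) =>
        ⨅ (t : ℕ → Set Y) (_ : S ⊆ ⋃ n, t n) (_ : ∀ n, Metric.ediam (t n) ≤ r),
          ∑' n, ⨆ _ : (t n).Nonempty, Metric.ediam (t n) ^ d) (e (k + 1)) (he0 (k + 1))
    simp only [iInf_lt_iff] at h1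
    obtain ⟨t, h2, h3, h4⟩ := h1
    refine ⟨t, h2, h3, le_trans (ENNReal.tsum_le_tsum fun n => ?_) h4.le⟩
    rcases (t n).eq_empty_or_nonempty with hn | hn
    · simp [hn, hd]
    · simp [hn]
  choose t ht1 ht2 ht3 using hcov
  have hfin : ∀ k n, Metric.ediam (t k n) ≠ ∞ := fun k n =>
    ne_top_of_le_ne_top (by simp [e]) (ht2 k n)
  choose u hu1 hu2 using fun k n => slice_cover A G f hf c M hc hM h N hN (t k n) (hfin k n)
  have hlim : Tendsto (fun k : ℕ => e (k + 1)) atTop (𝓝 0) :=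
    (tendsto_add_atTop_iff_nat 1).2 ENNReal.tendsto_inv_nat_nhds_zero
  have := Measure.hausdorffMeasure_le_liminf_tsum (ι := fun _ : ℕ => ℕ × Fin (2 * N + 1)) d A
    (l := atTop) (fun k => L * e (k + 1))
    (by simpa using ENNReal.Tendsto.const_mul hlim (Or.inr hLt))
    (fun k i => u k i.1 i.2)
    (Eventually.of_forall fun k i => (hu2 k i.1 i.2).trans (by gcongr; exact ht2 k i.1))
    (Eventually.of_forall fun k a ha => by
      obtain ⟨n, hn⟩ := mem_iUnion.1 (ht1 k (hG ha))
      obtain ⟨m, hm⟩ := mem_iUnion.1 (hu1 k n ⟨ha, hn⟩)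
      exact mem_iUnion.2 ⟨(n, m), hm⟩)
  refine this.trans ?_
  have hb : ∀ k, ∑' i : ℕ × Fin (2 * N + 1), Metric.ediam (u k i.1 i.2) ^ d
      ≤ Q * (μH[d] S + e (k + 1)) := by
    intro k
    rw [ENNReal.tsum_prod']
    calc _ ≤ ∑' n : ℕ, ∑' _m : Fin (2 * N + 1), (L * Metric.ediam (t k n)) ^ d := by
          refine ENNReal.tsum_le_tsum fun n => ENNReal.tsum_le_tsum fun m => ?_
          exact ENNReal.rpow_le_rpow (hu2 k n m) hd.le
      _ = ∑' n : ℕ, Q * Metric.ediam (t k n) ^ d := by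
          congr 1; ext n
          rw [tsum_fintype, Finset.sum_const, ENNReal.mul_rpow_of_nonneg _ _ hd.le, hQ]
          simp [mul_assoc]
      _ = Q * ∑' n : ℕ, Metric.ediam (t k n) ^ d := ENNReal.tsum_mul_left
      _ ≤ _ := by gcongr; exact ht3 k
  have hl2 : Tendsto (fun k : ℕ => Q * (μH[d] S + e (k + 1))) atTop (𝓝 (Q * μH[d] S)) := by
    refine ENNReal.Tendsto.const_mul ?_ (Or.inr hQt)
    simpa using (tendsto_const_nhds (x := μH[d] S)).add hlim
  rw [← hl2.liminf_eq]
  exact liminf_le_liminf (Eventually.of_forall hb)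

lemma g_lip (p : ℝ) (hp : 0 < p) (τ b : ℝ) (hτ : 0 < τ) (hb0 : 0 < b) (hb1 : b ≤ 1)
    (w w' : ℝ) (hw : w ∈ Icc τ 1) (hw' : w' ∈ Icc τ 1) :
    |(1 - b + b * w ^ p) ^ (1 / p) - (1 - b + b * w' ^ p) ^ (1 / p)| ≤ 1 / τ * |w - w'| := by
  have hτ1 : τ ≤ 1 := hw.1.trans hw.2
  have hder : ∀ x ∈ Icc τ 1, HasDerivWithinAt (fun x : ℝ => (1 - b + b * x ^ p) ^ (1 / p))
      (b * (p * x ^ (p - 1)) * (1 / p) * (1 - b + b * x ^ p) ^ (1 / p - 1)) (Icc τ 1) x := by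
    intro x hx
    have hx0 : 0 < x := hτ.trans_le hx.1
    have hpos : 0 < 1 - b + b * x ^ p := by
      have : 0 < b * x ^ p := by positivity
      linarith
    have h1 : HasDerivAt (fun x : ℝ => 1 - b + b * x ^ p) (b * (p * x ^ (p - 1))) x :=
      ((Real.hasDerivAt_rpow_const (Or.inl hx0.ne')).const_mul b).const_add (1 - b)
    exact (h1.rpow_const (Or.inl hpos.ne')).hasDerivWithinAt
  have hbound : ∀ x ∈ Icc τ 1,
      ‖b * (p * x ^ (p - 1)) * (1 / p) * (1 - b + b * x ^ p) ^ (1 / p - 1)‖ ≤ 1 / τ := by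
    intro x hx
    have hx0 : 0 < x := hτ.trans_le hx.1
    have hxp1 : x ^ p ≤ 1 := Real.rpow_le_one hx0.le hx.2 hp.le
    have hxp0 : 0 < x ^ p := by positivity
    set q := 1 - b + b * x ^ p with hq
    have hqx : x ^ p ≤ q := by nlinarith
    have hq1 : q ≤ 1 := by nlinarith
    have hq0 : 0 < q := hxp0.trans_le hqx
    rw [Real.norm_of_nonneg (by positivity)]
    have e1 : b * (p * x ^ (p - 1)) * (1 / p) * q ^ (1 / p - 1)
        = b * (x ^ (p - 1) * q ^ (1 / p - 1)) := by field_simp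
    rw [e1]
    have h1τ : 1 ≤ 1 / τ := by rw [le_div_iff₀ hτ]; linarith
    have key : x ^ (p - 1) * q ^ (1 / p - 1) ≤ 1 / τ := by
      rcases le_total 1 p with h | h
      · refine le_trans ?_ h1τ
        have h2 : q ^ (1 / p - 1) ≤ (x ^ p) ^ (1 / p - 1) :=
          Real.rpow_le_rpow_of_nonpos hxp0 hqx (by
            rw [sub_nonpos, div_le_one hp]; exact h)
        calc _ ≤ x ^ (p - 1) * (x ^ p) ^ (1 / p - 1) := by gcongr
          _ = 1 := by
            rw [← Real.rpow_mul hx0.le, ← Real.rpow_add hx0]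
            have : p - 1 + p * (1 / p - 1) = 0 := by field_simp; ring
            rw [this, Real.rpow_zero]
      · have h2 : q ^ (1 / p - 1) ≤ 1 := Real.rpow_le_one hq0.le hq1 (by
            rw [sub_nonneg, le_div_iff₀ hp]; linarith)
        have h3 : x ^ (p - 1) ≤ x ^ (-1 : ℝ) :=
          Real.rpow_le_rpow_of_exponent_ge hx0 hx.2 (by linarith)
        rw [Real.rpow_neg_one] at h3
        have h4 : x⁻¹ ≤ 1 / τ := by rw [one_div]; exact inv_anti₀ hτ hx.1
        calc _ ≤ (1 / τ) * 1 := by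
              gcongr
              exact h3.trans h4
          _ = _ := mul_one _
    calc _ ≤ 1 * (1 / τ) := by gcongr
      _ = _ := one_mul _
  have := Convex.norm_image_sub_le_of_norm_hasDerivWithin_le hder hbound (convex_Icc τ 1) hw' hw
  simpa [Real.norm_eq_abs] using this

lemma tail_bound (p : ℝ) (hp : 0 < p) (n : ℕ) (hn : 2 ≤ n) (j : Fin n) (τ t : ℝ) (hτ : 0 < τ)
    (hτt : τ < t) (ht : t < 1) (N : ℕ) (hN : 0 < N) :
    μH[(n : ℝ) - 1] {x | x ∈ DeltaE p n ∧ t ≤ x j} ≤ ((2 * N + 1 : ℕ) : ℝ≥0∞) *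
      ENNReal.ofReal (((1 - t ^ p) / (1 - τ ^ p)) ^ (1 / p) + (1 / τ + 1) / N) ^ ((n : ℝ) - 1) *
      μH[(n : ℝ) - 1] (DeltaE p n) := by
  have htp1 : t ^ p < 1 := Real.rpow_lt_one (hτ.trans hτt).le ht hp
  have hτt' : τ ^ p < t ^ p := Real.rpow_lt_rpow hτ.le hτt hp
  have hτ0 : 0 < τ ^ p := by positivity
  set b : ℝ := (1 - t ^ p) / (1 - τ ^ p) with hb
  have hb0 : 0 < b := div_pos (by linarith) (by linarith)
  have hb1 : b ≤ 1 := by rw [hb, div_le_one (by linarith)]; linarith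
  set c : ℝ := b ^ (1 / p) with hc
  have hc0 : 0 < c := by positivity
  have hc1 : c ≤ 1 := Real.rpow_le_one hb0.le hb1 (by positivity)
  have hcp : c ^ p = b := by
    rw [hc, ← Real.rpow_mul hb0.le, one_div_mul_cancel hp.ne', Real.rpow_one]
  let hh : ℝ → ℝ := fun u => (1 - (1 - u ^ p) / b) ^ (1 / p)
  let G : EuclideanSpace ℝ (Fin n) → EuclideanSpace ℝ (Fin n) := fun a =>
    WithLp.toLp 2 fun i => if i = j then hh (a j) else a i / c
  have hGj : ∀ a, G a j = hh (a j) := fun a => by simp [G]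
  have hGi : ∀ a i, i ≠ j → G a i = a i / c := fun a i hi => by simp [G, hi]
  -- coordinates at most one
  have hle1 : ∀ a ∈ DeltaE p n, a j ^ p ≤ 1 := by
    rintro a ⟨h0, h1⟩
    rw [← h1]
    exact Finset.single_le_sum (f := fun i => a i ^ p)
      (fun i _ => Real.rpow_nonneg (h0 i) p) (Finset.mem_univ j)
  have hval : ∀ a, a ∈ DeltaE p n ∧ t ≤ a j → τ ^ p ≤ 1 - (1 - a j ^ p) / b ∧
      1 - (1 - a j ^ p) / b ≤ 1 := by
    rintro a ⟨ha, hta⟩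
    have h1 := hle1 a ha
    have h2 : t ^ p ≤ a j ^ p := Real.rpow_le_rpow (hτ.trans hτt).le hta hp.le
    constructor
    · have : (1 - a j ^ p) / b ≤ 1 - τ ^ p := by
        rw [div_le_iff₀ hb0, hb, mul_div_cancel₀ _ (by linarith)]
        linarith
      linarith
    · have : 0 ≤ (1 - a j ^ p) / b := div_nonneg (by linarith) hb0.le
      linarith
  have hhp : ∀ a, a ∈ DeltaE p n ∧ t ≤ a j → hh (a j) ^ p = 1 - (1 - a j ^ p) / b := by
    intro a ha
    simp only [hh]
    rw [← Real.rpow_mul (hτ0.le.trans (hval a ha).1), one_div_mul_cancel hp.ne', Real.rpow_one]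
  have hhmem : ∀ a, a ∈ DeltaE p n ∧ t ≤ a j → hh (a j) ∈ Icc τ 1 := by
    intro a ha
    have h0 := hτ0.le.trans (hval a ha).1
    constructor
    · have : τ = (τ ^ p) ^ (1 / p) := by
        rw [← Real.rpow_mul hτ.le, mul_one_div_cancel hp.ne', Real.rpow_one]
      rw [this]
      exact Real.rpow_le_rpow hτ0.le (hval a ha).1 (by positivity)
    · exact Real.rpow_le_one h0 (hval a ha).2 (by positivity)
  have hinv : ∀ a, a ∈ DeltaE p n ∧ t ≤ a j → (1 - b + b * hh (a j) ^ p) ^ (1 / p) = a j := by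
    intro a ha
    rw [hhp a ha]
    have : 1 - b + b * (1 - (1 - a j ^ p) / b) = a j ^ p := by field_simp; ring
    rw [this, ← Real.rpow_mul (ha.1.1 j), mul_one_div_cancel hp.ne', Real.rpow_one]
  refine hausdorff_slice _ _ G ?_ (fun x => x j) ?_ c (1 / τ + 1) hc0 (by positivity) ?_ N hN _ ?_
  · rintro a ha
    have ha' : a ∈ DeltaE p n ∧ t ≤ a j := ha
    refine ⟨fun i => ?_, ?_⟩
    · by_cases hi : i = j
      · subst hi; rw [hGj]; exact hτ.le.trans (hhmem a ha').1
      · rw [hGi a i hi]; exact div_nonneg (ha'.1.1 i) hc0.le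
    · have hs := ha'.1.2
      rw [← Finset.add_sum_erase _ _ (Finset.mem_univ j)] at hs ⊢
      have : ∑ i ∈ Finset.univ.erase j, G a i ^ p = (∑ i ∈ Finset.univ.erase j, a i ^ p) / b := by
        rw [Finset.sum_div]
        refine Finset.sum_congr rfl fun i hi => ?_
        rw [hGi a i (Finset.ne_of_mem_erase hi), Real.div_rpow (ha'.1.1 i) hc0.le, hcp]
      rw [this, hGj, hhp a ha', ← hs]
      field_simp
      linarith
  · intro y y'
    have := PiLp.norm_apply_le (y - y') j
    rw [dist_eq_norm]
    simpa using this
  · intro a ha a' ha'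
    have hdec : a - a' = c • (G a - G a') +
        EuclideanSpace.single j ((a j - a' j) - c * (G a j - G a' j)) := by
      ext i
      by_cases hi : i = j
      · subst hi; simp
      · simp [hi, hGi a i hi, hGi a' i hi]; field_simp
    have hl := g_lip p hp τ b hτ hb0 hb1 _ _ (hhmem a ha) (hhmem a' ha')
    rw [hinv a ha, hinv a' ha', ← hGj, ← hGj] at hl
    rw [dist_eq_norm, dist_eq_norm]
    calc ‖a - a'‖ ≤ ‖c • (G a - G a')‖ + ‖EuclideanSpace.single j
            ((a j - a' j) - c * (G a j - G a' j))‖ := by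
          conv_lhs => rw [hdec]
          exact norm_add_le _ _
      _ = c * ‖G a - G a'‖ + |(a j - a' j) - c * (G a j - G a' j)| := by
          rw [norm_smul, PiLp.norm_single, Real.norm_of_nonneg hc0.le, Real.norm_eq_abs]
      _ ≤ c * ‖G a - G a'‖ + (1 / τ + 1) * |G a j - G a' j| := by
          have h5 : |(a j - a' j) - c * (G a j - G a' j)| ≤ |a j - a' j| + |c * (G a j - G a' j)| :=
            abs_sub _ _
          rw [abs_mul c, abs_of_pos hc0] at h5
          have : c * |G a j - G a' j| ≤ 1 * |G a j - G a' j| := by gcongr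
          linarith
  · have : (2 : ℝ) ≤ n := by exact_mod_cast hn
    linarith

lemma num_bound (p : ℝ) (hp : 0 < p) (n : ℕ) (hn : 2 ≤ n) (s : ℝ)
    (hs : s = (8 * p + 12) * (Real.log (n + 1) / n)) (hs1 : s < 1) :
    ∃ N : ℕ, 0 < N ∧ (n : ℝ) * (((2 * N + 1 : ℕ) : ℝ) *
      (((1 - s) / (1 - s / 2)) ^ (1 / p) + (1 / (s / 2) ^ (1 / p) + 1) / N) ^ ((n : ℝ) - 1))
      ≤ 7 * Real.exp (Real.exp (1 / (2 * p))) * (Real.log (n + 1) / n) ^ (1 / p) := by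
  have hn2 : (2 : ℝ) ≤ n := by exact_mod_cast hn
  have hn0 : (0 : ℝ) < n := by linarith
  have hlog : 1 ≤ Real.log (n + 1) := by
    rw [Real.le_log_iff_exp_le (by positivity)]
    linarith [Real.exp_one_lt_d9]
  have hs0 : 0 < s := by rw [hs]; positivity
  set τ : ℝ := (s / 2) ^ (1 / p) with hτ
  have hτ0 : 0 < τ := by positivity
  have hτ1 : τ ≤ 1 := Real.rpow_le_one (by positivity) (by linarith) (by positivity)
  have hiτ1 : 1 ≤ 1 / τ := by rw [le_div_iff₀ hτ0]; linarith
  have hiτ : 1 / τ ≤ ((n : ℝ) + 1) ^ (2 / p) := by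
    have h1 : 1 / τ = (1 / (s / 2)) ^ (1 / p) := by
      rw [hτ, Real.div_rpow zero_le_one (by positivity), Real.one_rpow]
    have h2 : 1 / (s / 2) ≤ ((n : ℝ) + 1) ^ (2 : ℝ) := by
      rw [div_le_iff₀ (by positivity), hs, Real.rpow_two]
      have : (1 : ℝ) / n ≤ Real.log (n + 1) / n := by gcongr
      have h3 : (1 : ℝ) / n ≤ (8 * p + 12) * (Real.log (n + 1) / n) / 2 := by
        have : 0 < Real.log (n + 1) / n := by positivity
        nlinarith
      calc (1 : ℝ) = n * (1 / n) := by field_simp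
        _ ≤ (n + 1) ^ 2 * (1 / n) := by gcongr; nlinarith
        _ ≤ _ := by gcongr
    rw [h1, show (2 : ℝ) / p = 2 * (1 / p) by ring, Real.rpow_mul (by positivity)]
    exact Real.rpow_le_rpow (by positivity) h2 (by positivity)
  set m : ℕ := ⌈1 / τ + 1⌉₊ with hm
  have hm1 : 1 / τ + 1 ≤ m := Nat.le_ceil _
  have hm2 : (m : ℝ) < 1 / τ + 1 + 1 := Nat.ceil_lt_add_one (by positivity)
  have hm0 : (0 : ℝ) < m := by linarith
  refine ⟨n * m, Nat.mul_pos (by omega) (by exact_mod_cast hm0), ?_⟩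
  set B : ℝ := Real.exp (1 / (2 * p)) with hB
  have hN1 : (((2 * (n * m) + 1 : ℕ)) : ℝ) ≤ 7 * n * ((n : ℝ) + 1) ^ (2 / p) := by
    push_cast
    have : (m : ℝ) ≤ 3 * (1 / τ) := by linarith
    have h7 : 2 * ((n : ℝ) * m) + 1 ≤ 7 * n * (1 / τ) := by nlinarith
    exact h7.trans (by gcongr)
  have hc : ((1 - s) / (1 - s / 2)) ^ (1 / p) ≤ Real.exp (-(s / (2 * p))) := by
    have h1 : (1 - s) / (1 - s / 2) ≤ Real.exp (-(s / 2)) := by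
      refine le_trans ?_ (Real.one_sub_le_exp_neg (s / 2))
      rw [div_le_iff₀ (by linarith)]; nlinarith
    have h0 : 0 ≤ (1 - s) / (1 - s / 2) := div_nonneg (by linarith) (by linarith)
    refine (Real.rpow_le_rpow h0 h1 (by positivity)).trans ?_
    rw [← Real.exp_mul]
    apply le_of_eq; congr 1; field_simp
  have hq : (1 / τ + 1) / ((n * m : ℕ) : ℝ) ≤ 1 / n := by
    push_cast
    rw [div_le_div_iff₀ (by positivity) hn0]
    nlinarith
  have hc2 : ((1 - s) / (1 - s / 2)) ^ (1 / p) + (1 / τ + 1) / ((n * m : ℕ) : ℝ)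
      ≤ Real.exp (-(s / (2 * p)) + B / n) := by
    have h1 : 1 ≤ Real.exp (-(s / (2 * p))) * B := by
      rw [hB, ← Real.exp_add]
      apply Real.one_le_exp
      have : s / (2 * p) ≤ 1 / (2 * p) := by gcongr
      linarith
    calc _ ≤ Real.exp (-(s / (2 * p))) + 1 / n := add_le_add hc hq
      _ ≤ Real.exp (-(s / (2 * p))) + (Real.exp (-(s / (2 * p))) * B) / n := by gcongr
      _ = Real.exp (-(s / (2 * p))) * (B / n + 1) := by ring
      _ ≤ Real.exp (-(s / (2 * p))) * Real.exp (B / n) := by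
          gcongr; exact Real.add_one_le_exp _
      _ = _ := by rw [Real.exp_add]
  have h00 : 0 ≤ ((1 - s) / (1 - s / 2)) ^ (1 / p) + (1 / τ + 1) / ((n * m : ℕ) : ℝ) := by
    have h0 : 0 ≤ (1 - s) / (1 - s / 2) := div_nonneg (by linarith) (by linarith)
    positivity
  have hpow : (((1 - s) / (1 - s / 2)) ^ (1 / p) + (1 / τ + 1) / ((n * m : ℕ) : ℝ))
      ^ ((n : ℝ) - 1) ≤ ((n : ℝ) + 1) ^ (-(2 + 3 / p)) * Real.exp B := by
    refine (Real.rpow_le_rpow h00 hc2 (by linarith)).trans ?_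
    rw [← Real.exp_mul, Real.rpow_def_of_pos (by positivity), ← Real.exp_add]
    apply Real.exp_le_exp.2
    have hB0 : 0 < B := Real.exp_pos _
    have e1 : B / n * ((n : ℝ) - 1) ≤ B := by
      rw [div_mul_eq_mul_div, div_le_iff₀ hn0]; nlinarith
    have e2 : Real.log (n + 1) * (2 + 3 / p) ≤ s / (2 * p) * (n - 1) := by
      have : Real.log (n + 1) * (2 + 3 / p) = s / (2 * p) * (n / 2) := by
        rw [hs]; field_simp; ring
      rw [this]
      gcongr; linarith
    nlinarith
  calc _ ≤ (n : ℝ) * ((7 * n * ((n : ℝ) + 1) ^ (2 / p)) *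
        (((n : ℝ) + 1) ^ (-(2 + 3 / p)) * Real.exp B)) := by gcongr
    _ = 7 * Real.exp B * ((n : ℝ) ^ 2 * (((n : ℝ) + 1) ^ (2 / p) *
          ((n : ℝ) + 1) ^ (-(2 + 3 / p)))) := by ring
    _ ≤ 7 * Real.exp B * (((n : ℝ) + 1) ^ (2 : ℝ) * (((n : ℝ) + 1) ^ (2 / p) *
          ((n : ℝ) + 1) ^ (-(2 + 3 / p)))) := by
        rw [Real.rpow_two]; gcongr; linarith
    _ = 7 * Real.exp B * ((n : ℝ) + 1) ^ (-(1 / p)) := by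
        rw [← Real.rpow_add (by positivity), ← Real.rpow_add (by positivity)]
        congr 2; ring
    _ ≤ 7 * Real.exp B * (n : ℝ) ^ (-(1 / p)) := by
        gcongr 7 * Real.exp B * ?_
        exact Real.rpow_le_rpow_of_nonpos hn0 (by linarith) (by simp [hp.le])
    _ = 7 * Real.exp B * (1 / (n : ℝ)) ^ (1 / p) := by
        rw [Real.rpow_neg hn0.le, one_div (n : ℝ), Real.inv_rpow hn0.le]
    _ ≤ _ := by gcongr

lemma measurableSet_DeltaE (p : ℝ) (hp : 0 < p) (n : ℕ) : MeasurableSet (DeltaE p n) := by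
  have h1 : IsClosed {t : EuclideanSpace ℝ (Fin n) | ∀ i, 0 ≤ t i} := by
    simp only [setOf_forall]
    exact isClosed_iInter fun i => isClosed_le continuous_const (by fun_prop)
  have h2 : IsClosed {t : EuclideanSpace ℝ (Fin n) | ∑ i, t i ^ p = 1} := by
    refine isClosed_eq ?_ continuous_const
    refine continuous_finsetSum _ fun i _ => ?_
    exact Continuous.rpow_const (by fun_prop) fun _ => Or.inr hp.le
  exact (h1.inter h2).measurableSet

/-- For `0 < p < ∞` there is `C_p > 0` depending only on `p` such that for all `n ≥ 2`,
`σ_0^{p,∞}(ρ_p) = ∫_{Δ_p^n} max_j x_j dρ_p(x) ≤ C_p (log(n+1)/n)^{1/p}`. -/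
theorem surface_measure_zero_width_upper (p : ℝ) (hp : 0 < p) :
    ∃ C : ℝ, 0 < C ∧ ∀ n : ℕ, 2 ≤ n →
      ∀ ρ : Measure (EuclideanSpace ℝ (Fin n)), IsSurfaceMeasureE p n ρ →
        ∫ x, (⨆ j, x j) ∂ρ ≤ C * (Real.log (n + 1) / n) ^ (1 / p) := by
  refine ⟨(8 * p + 12) ^ (1 / p) + 7 * Real.exp (Real.exp (1 / (2 * p))), by positivity, ?_⟩
  intro n hn ρ hρ
  have hn2 : (2 : ℝ) ≤ n := by exact_mod_cast hn
  have hlog : 0 < Real.log (n + 1) := Real.log_pos (by linarith)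
  have hl0 : 0 < Real.log (n + 1) / n := by positivity
  have : Nonempty (Fin n) := ⟨⟨0, by omega⟩⟩
  set H : ℝ≥0∞ := μH[(n : ℝ) - 1] (DeltaE p n) with hH
  have hρ' : ρ = H⁻¹ • (μH[(n : ℝ) - 1]).restrict (DeltaE p n) := hρ
  by_cases hH0 : H = 0
  · have : ρ = 0 := by rw [hρ', Measure.restrict_eq_zero.2 hH0, smul_zero]
    rw [this, integral_zero_measure]; positivity
  by_cases hHt : H = ∞
  · have : ρ = 0 := by rw [hρ', hHt, ENNReal.inv_top, zero_smul]
    rw [this, integral_zero_measure]; positivity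
  have hprob : IsProbabilityMeasure ρ := ⟨by
    rw [hρ', Measure.smul_apply, Measure.restrict_apply_univ, smul_eq_mul]
    exact ENNReal.inv_mul_cancel hH0 hHt⟩
  have hae : ∀ᵐ x ∂ρ, x ∈ DeltaE p n := by
    rw [hρ']
    exact Measure.ae_smul_measure (ae_restrict_mem (measurableSet_DeltaE p hp n)) _
  have hle1 : ∀ x ∈ DeltaE p n, ∀ j, x j ≤ 1 := by
    rintro x ⟨h0, h1⟩ j
    by_contra! hlt
    have h2 : 1 < x j ^ p := Real.one_lt_rpow hlt hp
    have h3 : x j ^ p ≤ ∑ i, x i ^ p := Finset.single_le_sum (f := fun i => x i ^ p)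
      (fun i _ => Real.rpow_nonneg (h0 i) p) (Finset.mem_univ j)
    linarith
  have hnn : 0 ≤ᵐ[ρ] fun x : EuclideanSpace ℝ (Fin n) => ⨆ j, x j := by
    filter_upwards [hae] with x hx
    exact Real.iSup_nonneg hx.1
  set s : ℝ := (8 * p + 12) * (Real.log (n + 1) / n) with hs
  have hs0 : 0 < s := by positivity
  set t : ℝ := s ^ (1 / p) with ht
  have ht0 : 0 < t := by positivity
  have htt : t = (8 * p + 12) ^ (1 / p) * (Real.log (n + 1) / n) ^ (1 / p) := by
    rw [ht, hs, Real.mul_rpow (by positivity) hl0.le]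
  rcases le_or_gt 1 s with hs1 | hs1
  · have h1t : 1 ≤ t := Real.one_le_rpow hs1 (by positivity)
    have : ∫ x, (⨆ j, x j) ∂ρ ≤ ∫ _x, (1 : ℝ) ∂ρ := by
      refine integral_mono_of_nonneg hnn (integrable_const _) ?_
      filter_upwards [hae] with x hx
      exact ciSup_le (hle1 x hx)
    have h2 : ∫ _x, (1 : ℝ) ∂ρ = 1 := by simp
    rw [add_mul, ← htt]
    have : 0 ≤ 7 * Real.exp (Real.exp (1 / (2 * p))) * (Real.log (n + 1) / n) ^ (1 / p) := by
      positivity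
    linarith
  obtain ⟨N, hN, hbd⟩ := num_bound p hp n hn s hs hs1
  set τ : ℝ := (s / 2) ^ (1 / p) with hτ
  have hτ0 : 0 < τ := by positivity
  have hτp : τ ^ p = s / 2 := by
    rw [hτ, ← Real.rpow_mul (by positivity), one_div_mul_cancel hp.ne', Real.rpow_one]
  have htp : t ^ p = s := by
    rw [ht, ← Real.rpow_mul (by positivity), one_div_mul_cancel hp.ne', Real.rpow_one]
  have hτt : τ < t := Real.rpow_lt_rpow (by positivity) (by linarith) (by positivity)
  have ht1 : t < 1 := Real.rpow_lt_one hs0.le hs1 (by positivity)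
  set E : ℝ := ((2 * N + 1 : ℕ) : ℝ) *
      (((1 - s) / (1 - s / 2)) ^ (1 / p) + (1 / τ + 1) / N) ^ ((n : ℝ) - 1) with hE
  have hbase : 0 ≤ ((1 - s) / (1 - s / 2)) ^ (1 / p) + (1 / τ + 1) / N := by
    have h0 : 0 ≤ (1 - s) / (1 - s / 2) := div_nonneg (by linarith) (by linarith)
    positivity
  have hE0 : 0 ≤ E := by positivity
  let A : Fin n → Set (EuclideanSpace ℝ (Fin n)) := fun j => {x | t ≤ x j}
  have hAm : ∀ j, MeasurableSet (A j) := fun j =>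
    (isClosed_le continuous_const (by fun_prop)).measurableSet
  have htail : ∀ j, ρ (A j) ≤ ENNReal.ofReal E := by
    intro j
    have h1 := tail_bound p hp n hn j τ t hτ0 hτt ht1 N hN
    rw [htp, hτp] at h1
    have h2 : A j ∩ DeltaE p n = {x | x ∈ DeltaE p n ∧ t ≤ x j} := by
      ext x; exact and_comm
    rw [hρ', Measure.smul_apply, Measure.restrict_apply (hAm j), h2, smul_eq_mul, hE,
      ENNReal.ofReal_mul (by positivity), ENNReal.ofReal_natCast,
      ← ENNReal.ofReal_rpow_of_nonneg hbase (by linarith)]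
    calc _ ≤ H⁻¹ * _ := mul_le_mul_right h1 _
      _ = _ := by
        rw [← hH, mul_comm, mul_assoc, ENNReal.mul_inv_cancel hH0 hHt, mul_one]
  have hU : ρ.real (⋃ j, A j) ≤ n * E := by
    refine (measureReal_iUnion_fintype_le A).trans ?_
    calc _ ≤ ∑ _j : Fin n, E := Finset.sum_le_sum fun j _ =>
          ENNReal.toReal_le_of_le_ofReal hE0 (htail j)
      _ = _ := by simp
  have hUm : MeasurableSet (⋃ j, A j) := MeasurableSet.iUnion hAm
  have hint : Integrable ((⋃ j, A j).indicator fun _ => (1 : ℝ)) ρ :=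
    (integrable_const _).indicator hUm
  have hmain : ∫ x, (⨆ j, x j) ∂ρ ≤ ∫ x, (t + (⋃ j, A j).indicator (fun _ => (1 : ℝ)) x) ∂ρ := by
    refine integral_mono_of_nonneg hnn ((integrable_const _).add hint) ?_
    filter_upwards [hae] with x hx
    by_cases hxU : x ∈ ⋃ j, A j
    · rw [indicator_of_mem hxU]
      have : (⨆ j, x j) ≤ 1 := ciSup_le (hle1 x hx)
      linarith
    · rw [indicator_of_notMem hxU, add_zero]
      refine ciSup_le fun j => ?_
      by_contra! hlt
      exact hxU (mem_iUnion.2 ⟨j, hlt.le⟩)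
  rw [integral_add (integrable_const _) hint, integral_indicator_const _ hUm] at hmain
  simp only [integral_const, probReal_univ, smul_eq_mul, one_mul, mul_one] at hmain
  rw [add_mul, ← htt]
  linarith

end
end

section
/- Let 0<p<∞, β>−1 and n ≥ 2. Then: (i) for every 1 ≤ m ≤ n, σ_{m−1}^{p,∞}(θ_{p,β}) = ∫_{Δ_p^n} x_m* dθ_{p,β}(x) = (E[ω_m* Π_{i=1}^n ω_i^β] / E[Π_{i=1}^n ω_i^β]) · Γ(n(β+1)/p) / Γ(n(β+1)/p + 1/p); and (ii) E[Π_{i=1}^n ω_i^β] = ((c_p/p) · Γ((β+1)/p))^n. -/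
open MeasureTheory Real Set
open scoped ENNReal

noncomputable section

/-- The positive part `Δ_p^n` of the unit sphere of `ℓ_p^n`:
`Δ_p^n = {t ∈ [0,∞)^n : ∑_j t_j^p = 1}`. -/
def Delta (p : ℝ) (n : ℕ) : Set (Fin n → ℝ) :=
  {t | (∀ i, 0 ≤ t i) ∧ ∑ i, t i ^ p = 1}

/-- The cone `[0,1] · A = {t • a : t ∈ [0,1], a ∈ A}`. -/
def cone {n : ℕ} (A : Set (Fin n → ℝ)) : Set (Fin n → ℝ) :=
  {x | ∃ t ∈ Icc (0 : ℝ) 1, ∃ a ∈ A, x = t • a}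

/-- `μ` is the normalized cone measure on `Δ_p^n`: it is a Borel probability measure with
`μ(A) = λ([0,1]·A) / λ([0,1]·Δ_p^n)` for every Borel `A ⊆ Δ_p^n`. -/
def IsConeMeasure (p : ℝ) (n : ℕ) (μ : Measure (Fin n → ℝ)) : Prop :=
  IsProbabilityMeasure μ ∧
    ∀ A : Set (Fin n → ℝ), MeasurableSet A → A ⊆ Delta p n →
      μ A = volume (cone A) / volume (cone (Delta p n))

/-- The distribution on `[0,∞)` with density `c_p e^{-t^p}`, `c_p = p / Γ(1/p)`. -/
def expMeasure (p : ℝ) : Measure ℝ :=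
  (volume.restrict (Ioi (0 : ℝ))).withDensity fun t =>
    ENNReal.ofReal ((p / Real.Gamma (1 / p)) * Real.exp (-(t ^ p)))

/-- Joint distribution of `n` i.i.d. random variables with density `c_p e^{-t^p}` on `[0,∞)`. -/
def iidExp (p : ℝ) (n : ℕ) : Measure (Fin n → ℝ) := Measure.pi fun _ => expMeasure p


/-- The distribution on `(0,∞)` with density proportional to `t^β e^{-t^p}`. -/
def gmeasure (p β : ℝ) : Measure ℝ :=
  (volume.restrict (Ioi (0 : ℝ))).withDensity fun t =>
    ENNReal.ofReal ((∫ s in Ioi (0 : ℝ), s ^ β * Real.exp (-(s ^ p)))⁻¹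
      * (t ^ β * Real.exp (-(t ^ p))))

/-- The measure `θ_{p,β}` on `Δ_p^n`: the distribution of `ω'/‖ω'‖_p`, where `ω'_1, …, ω'_n`
are i.i.d. with density proportional to `t^β e^{-t^p}` on `(0,∞)`. -/
def thetaMeasure (p β : ℝ) (n : ℕ) : Measure (Fin n → ℝ) :=
  Measure.map (fun ω i => ω i / (∑ j, |ω j| ^ p) ^ (1 / p))
    (Measure.pi fun _ : Fin n => gmeasure p β)

lemma aux_lintegral_prod {n : ℕ} (μ : Fin n → Measure ℝ) [∀ i, SigmaFinite (μ i)]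
    (f : Fin n → ℝ → ℝ≥0∞) (hf : ∀ i, Measurable (f i)) :
    ∫⁻ x, ∏ i, f i (x i) ∂(Measure.pi μ) = ∏ i, ∫⁻ x, f i x ∂(μ i) := by
  induction n with
  | zero => simp
  | succ n ih =>
    have h := (measurePreserving_piFinSuccAbove μ 0).symm
    rw [← h.lintegral_comp (by fun_prop)]
    rw [Fin.prod_univ_succ, ← ih _ _ (fun i => hf i.succ),
      ← lintegral_prod_mul (f := fun x => f 0 x) (g := fun y : Fin n → ℝ => ∏ i, f i.succ (y i))
      (hf 0).aemeasurable
      (Finset.measurable_prod _ fun i _ => (hf i.succ).comp (measurable_pi_apply i)).aemeasurable]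
    refine lintegral_congr fun x => ?_
    rw [Fin.prod_univ_succ]
    rfl

lemma aux_pi_withDensity {n : ℕ} (μ : Measure ℝ) [SigmaFinite μ]
    (f : ℝ → ℝ≥0∞) (hf : Measurable f) [SigmaFinite (μ.withDensity f)] :
    Measure.pi (fun _ : Fin n => μ.withDensity f)
      = (Measure.pi (fun _ : Fin n => μ)).withDensity (fun x => ∏ i, f (x i)) := by
  refine Measure.pi_eq (fun s hs => ?_)
  rw [withDensity_apply _ (MeasurableSet.univ_pi hs), Measure.restrict_pi_pi,
    aux_lintegral_prod _ (fun _ => f) (fun _ => hf)]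
  exact Finset.prod_congr rfl fun i _ => (withDensity_apply _ (hs i)).symm

lemma aux_scaling {n : ℕ} (b : ℝ) (hb : 0 < b) (F : (Fin n → ℝ) → ℝ≥0∞) (hF : Measurable F) :
    ENNReal.ofReal (b ^ n) *
      ∫⁻ x, F (b • x) ∂(Measure.pi fun _ : Fin n => (volume : Measure ℝ).restrict (Ioi 0))
      = ∫⁻ x, F x ∂(Measure.pi fun _ : Fin n => (volume : Measure ℝ).restrict (Ioi 0)) := by
  rw [← Measure.restrict_pi_pi, ← volume_pi]
  have hS : MeasurableSet (Set.pi univ fun _ : Fin n => Ioi (0:ℝ)) :=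
    MeasurableSet.univ_pi fun _ => measurableSet_Ioi
  rw [← lintegral_indicator hS, ← lintegral_indicator hS]
  set G := (Set.pi univ fun _ : Fin n => Ioi (0:ℝ)).indicator F with hG
  have hGm : Measurable G := hF.indicator hS
  have h1 : ∀ x, (Set.pi univ fun _ : Fin n => Ioi (0:ℝ)).indicator (fun x => F (b • x)) x
      = G (b • x) := by
    intro x
    simp only [hG, indicator, Set.mem_pi, mem_univ, mem_Ioi, true_implies, Pi.smul_apply,
      smul_eq_mul, mul_pos_iff_of_pos_left hb]
  simp_rw [h1]
  rw [← lintegral_map (μ := volume) hGm (measurable_const_smul b),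
    Measure.map_addHaar_smul _ hb.ne', lintegral_smul_measure, smul_eq_mul, ← mul_assoc,
    ← ENNReal.ofReal_mul (by positivity)]
  have : b ^ n * |(b ^ Module.finrank ℝ (Fin n → ℝ))⁻¹| = 1 := by
    rw [Module.finrank_fin_fun, abs_of_pos (by positivity)]
    exact mul_inv_cancel₀ (by positivity)
  rw [this]; simp

lemma aux_gamma (s r : ℝ) (hs : 0 < s) (hr : 0 < r) :
    ∫⁻ t in Ioi (0:ℝ), ENNReal.ofReal (t ^ (s - 1)) * ENNReal.ofReal (exp (-(r * t)))
      = ENNReal.ofReal (r ^ (-s)) * ENNReal.ofReal (Real.Gamma s) := by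
  have h := integral_rpow_mul_exp_neg_mul_Ioi hs hr
  have hpos : 0 < (1 / r) ^ s * Real.Gamma s := mul_pos (by positivity) (Real.Gamma_pos_of_pos hs)
  have hint : IntegrableOn (fun t : ℝ => t ^ (s - 1) * exp (-(r * t))) (Ioi 0) :=
    .of_integral_ne_zero (by rw [h]; exact hpos.ne')
  rw [← ENNReal.ofReal_mul (by positivity), rpow_neg hr.le, ← inv_rpow hr.le, ← one_div, ← h,
    ofReal_integral_eq_lintegral_ofReal hint]
  · refine setLIntegral_congr_fun measurableSet_Ioi fun t ht => ?_
    have : (0:ℝ) < t := ht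
    rw [ENNReal.ofReal_mul (by positivity)]
  · refine (ae_restrict_iff' measurableSet_Ioi).2 (ae_of_all _ fun t ht => ?_)
    have : (0:ℝ) < t := ht
    simp only [Pi.zero_apply]; positivity

lemma aux_beta (s k : ℝ) (hs : 0 < s) (hk : s < k) :
    ENNReal.ofReal (Real.Gamma k) *
      ∫⁻ a in Ioi (0:ℝ), ENNReal.ofReal (a ^ (s - 1)) * ENNReal.ofReal ((1 + a) ^ (-k))
      = ENNReal.ofReal (Real.Gamma s) * ENNReal.ofReal (Real.Gamma (k - s)) := by
  have h1 : ENNReal.ofReal (Real.Gamma k) *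
      ∫⁻ a in Ioi (0:ℝ), ENNReal.ofReal (a ^ (s - 1)) * ENNReal.ofReal ((1 + a) ^ (-k))
      = ∫⁻ a in Ioi (0:ℝ), ∫⁻ t in Ioi (0:ℝ), ENNReal.ofReal (a ^ (s - 1)) *
        (ENNReal.ofReal (t ^ (k - 1)) * ENNReal.ofReal (exp (-((1 + a) * t)))) := by
    rw [← lintegral_const_mul _ (by fun_prop)]
    refine setLIntegral_congr_fun measurableSet_Ioi fun a ha => ?_
    have ha' : (0:ℝ) < a := ha
    rw [lintegral_const_mul _ (by fun_prop), aux_gamma k (1 + a) (hs.trans hk) (by linarith)]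
    ring
  rw [h1, lintegral_lintegral_swap (by fun_prop)]
  have h2 := aux_gamma (k - s) 1 (by linarith) one_pos
  rw [one_rpow, ENNReal.ofReal_one, one_mul] at h2
  rw [← h2, ← lintegral_const_mul _ (by fun_prop)]
  refine setLIntegral_congr_fun measurableSet_Ioi fun t ht => ?_
  have ht' : (0:ℝ) < t := ht
  calc _ = ∫⁻ a in Ioi (0:ℝ), (ENNReal.ofReal (t ^ (k - 1)) * ENNReal.ofReal (exp (-t))) *
        (ENNReal.ofReal (a ^ (s - 1)) * ENNReal.ofReal (exp (-(t * a)))) := by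
        refine lintegral_congr fun a => ?_
        have : exp (-((1 + a) * t)) = exp (-t) * exp (-(t * a)) := by
          rw [← exp_add]; ring_nf
        rw [this, ENNReal.ofReal_mul (exp_pos _).le]; ring
    _ = _ := by
        rw [lintegral_const_mul _ (by fun_prop), aux_gamma s t hs ht']
        have : t ^ (k - s - 1) = t ^ (k - 1) * t ^ (-s) := by
          rw [← rpow_add ht']; ring_nf
        rw [this, ENNReal.ofReal_mul (by positivity), one_mul]; ring

lemma aux_bdd {n : ℕ} (x : Fin n → ℝ) (m : ℕ) (hm : 1 ≤ m) :
    BddAbove {t : ℝ | ∃ S : Finset (Fin n), m ≤ S.card ∧ ∀ j ∈ S, t ≤ |x j|} := by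
  refine ⟨∑ j, |x j|, ?_⟩
  rintro t ⟨S, hS, h⟩
  obtain ⟨j, hj⟩ := Finset.card_pos.1 (lt_of_lt_of_le hm hS)
  exact (h j hj).trans (Finset.single_le_sum (f := fun j => |x j|)
    (fun i _ => abs_nonneg _) (Finset.mem_univ j))

lemma aux_zero_mem {n : ℕ} (x : Fin n → ℝ) (m : ℕ) (hm : m ≤ n) :
    (0:ℝ) ∈ {t : ℝ | ∃ S : Finset (Fin n), m ≤ S.card ∧ ∀ j ∈ S, t ≤ |x j|} :=
  ⟨Finset.univ, by simpa using hm, fun j _ => abs_nonneg _⟩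

lemma aux_kth_nonneg {n : ℕ} (x : Fin n → ℝ) (m : ℕ) (hm : 1 ≤ m) (hmn : m ≤ n) :
    0 ≤ kthMax x m := le_csSup (aux_bdd x m hm) (aux_zero_mem x m hmn)

lemma aux_kth_meas {n : ℕ} (m : ℕ) (hm : 1 ≤ m) (hmn : m ≤ n) :
    Measurable (fun x : Fin n → ℝ => kthMax x m) := by
  refine measurable_of_Ioi fun c => ?_
  have : (fun x : Fin n → ℝ => kthMax x m) ⁻¹' Ioi c
      = ⋃ S ∈ {S : Finset (Fin n) | m ≤ S.card}, ⋂ j ∈ S, {x : Fin n → ℝ | c < |x j|} := by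
    ext x
    simp only [mem_preimage, mem_Ioi, mem_iUnion, mem_iInter, mem_ofPred_eq, exists_prop, kthMax]
    rw [lt_csSup_iff (aux_bdd x m hm) ⟨0, aux_zero_mem x m hmn⟩]
    constructor
    · rintro ⟨b, ⟨S, hS, h⟩, hb⟩
      exact ⟨S, hS, fun j hj => hb.trans_le (h j hj)⟩
    · rintro ⟨S, hS, h⟩
      have hne : S.Nonempty := Finset.card_pos.1 (lt_of_lt_of_le hm hS)
      obtain ⟨j, hj, hmin⟩ := S.exists_min_image (fun j => |x j|) hne
      exact ⟨|x j|, ⟨S, hS, hmin⟩, h j hj⟩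
  rw [this]
  refine MeasurableSet.biUnion (Set.to_countable _) fun S _ => ?_
  refine Finset.measurableSet_biInter S fun j _ => ?_
  exact measurableSet_lt measurable_const (by fun_prop)

lemma aux_kth_smul {n : ℕ} (x : Fin n → ℝ) (m : ℕ) (b : ℝ) (hb : 0 < b) :
    kthMax (b • x) m = b * kthMax x m := by
  unfold kthMax
  rw [← smul_eq_mul, ← Real.sSup_smul_of_nonneg hb.le]
  congr 1
  ext t
  rw [Set.mem_smul_set_iff_inv_smul_mem₀ hb.ne']
  simp only [mem_ofPred_eq, Pi.smul_apply, smul_eq_mul, abs_mul, abs_of_pos hb]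
  simp only [inv_mul_le_iff₀ hb]

lemma aux_main {n : ℕ} (p β : ℝ) (hp : 0 < p) (hβ : -1 < β) (hn : 2 ≤ n)
    (m : ℕ) (hm : 1 ≤ m) (hmn : m ≤ n)
    (V : Measure (Fin n → ℝ))
    (hV : V = Measure.pi fun _ : Fin n => (volume : Measure ℝ).restrict (Ioi 0)) :
    (∀ᵐ x ∂V, ∀ i, 0 < x i) ∧
    ENNReal.ofReal (Real.Gamma (n * (β + 1) / p + 1 / p)) *
      ∫⁻ x, ENNReal.ofReal (kthMax x m) * (∏ i, ENNReal.ofReal (x i ^ β)) *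
        ENNReal.ofReal ((∑ i, x i ^ p) ^ (-(1 / p))) * ENNReal.ofReal (exp (-∑ i, x i ^ p)) ∂V
    = ENNReal.ofReal (Real.Gamma (n * (β + 1) / p)) *
      ∫⁻ x, ENNReal.ofReal (kthMax x m) * (∏ i, ENNReal.ofReal (x i ^ β)) *
        ENNReal.ofReal (exp (-∑ i, x i ^ p)) ∂V := by
  have hkm := aux_kth_meas (n := n) m hm hmn
  have hpos : ∀ᵐ x ∂V, ∀ i, 0 < x i := by
    rw [hV, ← Measure.restrict_pi_pi]
    refine (ae_restrict_iff' (MeasurableSet.univ_pi fun _ => measurableSet_Ioi)).2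
      (ae_of_all _ fun x hx i => ?_)
    exact hx i (mem_univ i)
  refine ⟨hpos, ?_⟩
  have : SigmaFinite V := by rw [hV]; infer_instance
  set k := n * (β + 1) / p + 1 / p with hk
  have hn0 : (0:ℝ) < n := by exact_mod_cast (by omega : 0 < n)
  have hN : 0 < n * (β + 1) / p := by
    have : 0 < β + 1 := by linarith
    positivity
  have hs : 0 < 1 / p := by positivity
  -- scaling
  set K : (Fin n → ℝ) → ℝ≥0∞ :=
    fun x => ENNReal.ofReal (kthMax x m) * (∏ i, ENNReal.ofReal (x i ^ β)) with hK
  have hKm : Measurable K := by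
    refine hkm.ennreal_ofReal.mul ?_
    fun_prop
  set J : ℝ → ℝ≥0∞ := fun a => ∫⁻ x, K x * ENNReal.ofReal (exp (-(a * ∑ i, x i ^ p))) ∂V with hJ
  have hJs : ∀ a, 0 < a → J a = ENNReal.ofReal (a ^ (-k)) * J 1 := by
    intro a ha
    set b := a ^ (1 / p) with hb
    have hb0 : 0 < b := by positivity
    have hbp : b ^ p = a := by
      rw [hb, ← rpow_mul ha.le, one_div, inv_mul_cancel₀ hp.ne', rpow_one]
    have h := aux_scaling (n := n) b hb0
      (fun x => K x * ENNReal.ofReal (exp (-(1 * ∑ i, x i ^ p)))) (by fun_prop)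
    rw [← hV] at h
    have h2 : ∫⁻ x, K (b • x) * ENNReal.ofReal (exp (-(1 * ∑ i, (b • x) i ^ p))) ∂V
        = ENNReal.ofReal (b * (b ^ β) ^ n) * J a := by
      rw [hJ]
      simp only
      rw [← lintegral_const_mul _ (by fun_prop)]
      refine lintegral_congr_ae (hpos.mono fun x hx => ?_)
      simp only [hK]
      rw [aux_kth_smul _ _ _ hb0]
      have e1 : ∀ i, (b • x) i ^ β = b ^ β * x i ^ β := fun i => by
        simp [mul_rpow hb0.le (hx i).le]
      have e2 : ∀ i, (b • x) i ^ p = a * x i ^ p := fun i => by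
        simp [mul_rpow hb0.le (hx i).le, hbp]
      simp_rw [e1, e2, one_mul, ← Finset.mul_sum,
        ENNReal.ofReal_mul (rpow_nonneg hb0.le β), Finset.prod_mul_distrib,
        ENNReal.ofReal_mul hb0.le]
      rw [Finset.prod_const, Finset.card_univ, Fintype.card_fin, ENNReal.ofReal_pow (by positivity)]
      ring
    have h3 : ENNReal.ofReal (b ^ n) * (ENNReal.ofReal (b * (b ^ β) ^ n) * J a) = J 1 := by
      rw [← h2]; exact h
    rw [← h3, ← mul_assoc, ← mul_assoc, ← ENNReal.ofReal_mul (by positivity),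
      ← ENNReal.ofReal_mul (by positivity)]
    have : a ^ (-k) * b ^ n * (b * (b ^ β) ^ n) = 1 := by
      have e : b ^ n * (b * (b ^ β) ^ n) = a ^ k := by
        rw [← rpow_natCast, ← rpow_natCast, ← rpow_mul hb0.le]
        nth_rewrite 2 [← rpow_one b]
        rw [← rpow_add hb0, ← rpow_add hb0, hb, ← rpow_mul ha.le, hk]
        congr 1; field_simp; ring
      rw [mul_assoc, e, ← rpow_add ha]; simp
    rw [this]; simp
  have hT : ENNReal.ofReal (Real.Gamma (1 / p)) * ∫⁻ x, K x *
        ENNReal.ofReal ((∑ i, x i ^ p) ^ (-(1 / p))) * ENNReal.ofReal (exp (-∑ i, x i ^ p)) ∂V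
      = J 1 * ∫⁻ a in Ioi (0:ℝ), ENNReal.ofReal (a ^ (1 / p - 1)) *
          ENNReal.ofReal ((1 + a) ^ (-k)) := by
    have h1 : ENNReal.ofReal (Real.Gamma (1 / p)) * ∫⁻ x, K x *
        ENNReal.ofReal ((∑ i, x i ^ p) ^ (-(1 / p))) * ENNReal.ofReal (exp (-∑ i, x i ^ p)) ∂V
        = ∫⁻ x, (∫⁻ a in Ioi (0:ℝ), (K x * ENNReal.ofReal (exp (-∑ i, x i ^ p))) *
          (ENNReal.ofReal (a ^ (1 / p - 1)) * ENNReal.ofReal (exp (-((∑ i, x i ^ p) * a))))) ∂V := by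
      rw [← lintegral_const_mul _ (by fun_prop)]
      refine lintegral_congr_ae (hpos.mono fun x hx => ?_)
      have hR : 0 < ∑ i, x i ^ p :=
        Finset.sum_pos (fun i _ => rpow_pos_of_pos (hx i) p) ⟨⟨0, by omega⟩, Finset.mem_univ _⟩
      simp only
      rw [lintegral_const_mul _ (by fun_prop), aux_gamma (1 / p) _ hs hR]
      ring
    rw [h1, lintegral_lintegral_swap (by fun_prop), ← lintegral_const_mul _ (by fun_prop)]
    refine setLIntegral_congr_fun measurableSet_Ioi fun a ha => ?_
    have ha' : (0:ℝ) < a := ha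
    calc _ = ∫⁻ x, ENNReal.ofReal (a ^ (1 / p - 1)) *
            (K x * ENNReal.ofReal (exp (-((1 + a) * ∑ i, x i ^ p)))) ∂V := by
          refine lintegral_congr fun x => ?_
          have : exp (-((1 + a) * ∑ i, x i ^ p))
              = exp (-∑ i, x i ^ p) * exp (-((∑ i, x i ^ p) * a)) := by
            rw [← exp_add]; ring_nf
          rw [this, ENNReal.ofReal_mul (exp_pos _).le]; ring
      _ = ENNReal.ofReal (a ^ (1 / p - 1)) * J (1 + a) := by
          rw [lintegral_const_mul _ (by fun_prop)]
      _ = _ := by rw [hJs (1 + a) (by linarith)]; ring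
  have hB := aux_beta (1 / p) k hs (by rw [hk]; linarith)
  have hks : k - 1 / p = n * (β + 1) / p := by rw [hk]; ring
  rw [hks] at hB
  have hJ1 : J 1 = ∫⁻ x, K x * ENNReal.ofReal (exp (-∑ i, x i ^ p)) ∂V := by
    simp only [hJ, one_mul]
  rw [← hJ1]
  have hG0 : ENNReal.ofReal (Real.Gamma (1 / p)) ≠ 0 := by
    simpa using Real.Gamma_pos_of_pos hs
  rw [← ENNReal.mul_right_inj hG0 ENNReal.ofReal_ne_top, mul_left_comm, hT, mul_left_comm, hB]
  ring

/-- For `0 < p < ∞`, `β > -1`, `n ≥ 2`: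
(i) for `1 ≤ m ≤ n`, `σ_{m-1}^{p,∞}(θ_{p,β}) = ∫ x_m^* dθ_{p,β}
  = (E[ω_m^* ∏_i ω_i^β] / E[∏_i ω_i^β]) · Γ(n(β+1)/p)/Γ(n(β+1)/p + 1/p)`;
(ii) `E[∏_i ω_i^β] = ((c_p/p) Γ((β+1)/p))^n`. -/
theorem theta_measure_kth_max_formula (p β : ℝ) (hp : 0 < p) (hβ : -1 < β)
    (n : ℕ) (hn : 2 ≤ n) :
    (∀ m : ℕ, 1 ≤ m → m ≤ n →
      ∫ x, kthMax x m ∂(thetaMeasure p β n)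
        = ((∫ ω, kthMax ω m * ∏ i, ω i ^ β ∂(iidExp p n))
              / ∫ ω, ∏ i, ω i ^ β ∂(iidExp p n))
            * (Real.Gamma (n * (β + 1) / p) / Real.Gamma (n * (β + 1) / p + 1 / p))) ∧
    ∫ ω, ∏ i, ω i ^ β ∂(iidExp p n)
      = (p / Real.Gamma (1 / p) / p * Real.Gamma ((β + 1) / p)) ^ n := by
  have hZ : ∫ s in Ioi (0 : ℝ), s ^ β * Real.exp (-(s ^ p))
      = (1 / p) * Real.Gamma ((β + 1) / p) := integral_rpow_mul_exp_neg_rpow hp hβ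
  have hG1 : 0 < Real.Gamma (1 / p) := Real.Gamma_pos_of_pos (by positivity)
  have hG2 : 0 < Real.Gamma ((β + 1) / p) := Real.Gamma_pos_of_pos (div_pos (by linarith) hp)
  have hN : 0 < n * (β + 1) / p := by
    have : 0 < β + 1 := by linarith
    have : (0:ℝ) < n := by exact_mod_cast (by omega : 0 < n)
    positivity
  have hG3 : 0 < Real.Gamma (n * (β + 1) / p) := Real.Gamma_pos_of_pos hN
  have hG4 : 0 < Real.Gamma (n * (β + 1) / p + 1 / p) := Real.Gamma_pos_of_pos (by positivity)
  set c := p / Real.Gamma (1 / p) with hc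
  have hc0 : 0 < c := by positivity
  have : SigmaFinite (expMeasure p) := by unfold expMeasure; infer_instance
  have hii : ∫ ω, ∏ i, ω i ^ β ∂(iidExp p n)
      = (c / p * Real.Gamma ((β + 1) / p)) ^ n := by
    unfold iidExp
    rw [integral_fintype_prod_eq_pow (fun t : ℝ => t ^ β), Fintype.card_fin]
    congr 1
    unfold expMeasure
    rw [integral_withDensity_eq_integral_toReal_smul (by fun_prop) (by simp)]
    rw [show c / p * Real.Gamma ((β + 1) / p) = c * ((1 / p) * Real.Gamma ((β + 1) / p)) by ring,
      ← hZ, ← integral_const_mul]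
    refine integral_congr_ae (ae_of_all _ fun t => ?_)
    simp only
    rw [ENNReal.toReal_ofReal (by positivity), smul_eq_mul]
    ring
  refine ⟨fun m hm hmn => ?_, hii⟩
  rw [hii]
  set Z := ∫ s in Ioi (0 : ℝ), s ^ β * Real.exp (-(s ^ p)) with hZdef
  have hZ0 : 0 < Z := by rw [hZ]; positivity
  have hkm := aux_kth_meas (n := n) m hm hmn
  obtain ⟨V, hV⟩ : ∃ V, V = Measure.pi fun _ : Fin n => (volume : Measure ℝ).restrict (Ioi 0) :=
    ⟨_, rfl⟩
  obtain ⟨hpos, hmain⟩ := aux_main p β hp hβ hn m hm hmn V hV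
  have hprod : ∀ (d : ℝ) (x : Fin n → ℝ), 0 < d → (∀ i, 0 < x i) →
      ∏ i, ENNReal.ofReal (d * (x i ^ β * Real.exp (-(x i ^ p))))
      = ENNReal.ofReal (d ^ n) * (∏ i, ENNReal.ofReal (x i ^ β)) *
        ENNReal.ofReal (exp (-∑ i, x i ^ p)) := by
    intro d x hd hx
    simp_rw [ENNReal.ofReal_mul hd.le]
    have : ∀ i, ENNReal.ofReal (x i ^ β * Real.exp (-(x i ^ p)))
        = ENNReal.ofReal (x i ^ β) * ENNReal.ofReal (Real.exp (-(x i ^ p))) := fun i =>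
      ENNReal.ofReal_mul (rpow_nonneg (hx i).le _)
    simp_rw [this, Finset.prod_mul_distrib]
    rw [← Finset.sum_neg_distrib, Real.exp_sum,
      ENNReal.ofReal_prod_of_nonneg (fun i _ => (exp_pos _).le),
      Finset.prod_const, Finset.card_univ, Fintype.card_fin, ENNReal.ofReal_pow hd.le]
    ring
  set T := ∫⁻ x, ENNReal.ofReal (kthMax x m) * (∏ i, ENNReal.ofReal (x i ^ β)) *
        ENNReal.ofReal ((∑ i, x i ^ p) ^ (-(1 / p))) *
        ENNReal.ofReal (exp (-∑ i, x i ^ p)) ∂V with hT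
  set J := ∫⁻ x, ENNReal.ofReal (kthMax x m) * (∏ i, ENNReal.ofReal (x i ^ β)) *
        ENNReal.ofReal (exp (-∑ i, x i ^ p)) ∂V with hJ
  -- right-hand integral
  have hR : ∫ ω, kthMax ω m * ∏ i, ω i ^ β ∂(iidExp p n) = c ^ n * J.toReal := by
    have hd : iidExp p n = V.withDensity
        (fun x => ∏ i, ENNReal.ofReal (c * Real.exp (-(x i ^ p)))) := by
      have : SigmaFinite (((volume : Measure ℝ).restrict (Ioi 0)).withDensity
        fun t => ENNReal.ofReal (c * Real.exp (-(t ^ p)))) := by infer_instance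
      rw [hV]
      exact aux_pi_withDensity _ (fun t => ENNReal.ofReal (c * Real.exp (-(t ^ p)))) (by fun_prop)
    have hpos' : ∀ᵐ x ∂(iidExp p n), ∀ i, 0 < x i := by
      rw [hd]; exact (withDensity_absolutelyContinuous _ _).ae_le hpos
    have hmm : Measurable fun ω : Fin n → ℝ => kthMax ω m * ∏ i, ω i ^ β :=
      hkm.mul (by fun_prop)
    rw [integral_eq_lintegral_of_nonneg_ae (hpos'.mono fun x hx =>
        mul_nonneg (aux_kth_nonneg x m hm hmn)
          (Finset.prod_nonneg fun i _ => rpow_nonneg (hx i).le _)) hmm.aestronglyMeasurable,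
      hd, lintegral_withDensity_eq_lintegral_mul _ (by fun_prop) hmm.ennreal_ofReal]
    have : ∫⁻ x, (∏ i, ENNReal.ofReal (c * Real.exp (-(x i ^ p)))) *
        ENNReal.ofReal (kthMax x m * ∏ i, x i ^ β) ∂V = ENNReal.ofReal (c ^ n) * J := by
      rw [hJ, ← lintegral_const_mul' _ _ ENNReal.ofReal_ne_top]
      refine lintegral_congr_ae (hpos.mono fun x hx => ?_)
      have h := hprod c x hc0 hx
      beta_reduce
      rw [ENNReal.ofReal_mul (aux_kth_nonneg x m hm hmn),
        ENNReal.ofReal_prod_of_nonneg (fun i _ => rpow_nonneg (hx i).le _)]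
      rw [show (∏ i, ENNReal.ofReal (c * Real.exp (-(x i ^ p)))) *
        (ENNReal.ofReal (kthMax x m) * ∏ i, ENNReal.ofReal (x i ^ β)) =
        ENNReal.ofReal (kthMax x m) * ∏ i, ENNReal.ofReal (c * (x i ^ β * Real.exp (-(x i ^ p))))
        by
          rw [mul_left_comm, ← Finset.prod_mul_distrib]
          congr 1
          refine Finset.prod_congr rfl fun i _ => ?_
          rw [← ENNReal.ofReal_mul (by positivity)]
          congr 1; ring]
      rw [h]; ring
    simp only [Pi.mul_apply]
    rw [this, ENNReal.toReal_mul, ENNReal.toReal_ofReal (by positivity)]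
  have hL : ∫ x, kthMax x m ∂(thetaMeasure p β n) = (Z⁻¹) ^ n * T.toReal := by
    have hd : (Measure.pi fun _ : Fin n => gmeasure p β) = V.withDensity
        (fun x => ∏ i, ENNReal.ofReal (Z⁻¹ * (x i ^ β * Real.exp (-(x i ^ p))))) := by
      have : SigmaFinite (((volume : Measure ℝ).restrict (Ioi 0)).withDensity
        fun t => ENNReal.ofReal (Z⁻¹ * (t ^ β * Real.exp (-(t ^ p))))) := by infer_instance
      rw [hV]
      exact aux_pi_withDensity _
        (fun t => ENNReal.ofReal (Z⁻¹ * (t ^ β * Real.exp (-(t ^ p))))) (by fun_prop)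
    have hmap : Measurable (fun (ω : Fin n → ℝ) i => ω i / (∑ j, |ω j| ^ p) ^ (1 / p)) := by
      fun_prop
    have hmm : Measurable fun ω : Fin n → ℝ =>
        kthMax (fun i => ω i / (∑ j, |ω j| ^ p) ^ (1 / p)) m := hkm.comp hmap
    unfold thetaMeasure
    rw [integral_map hmap.aemeasurable hkm.aestronglyMeasurable,
      integral_eq_lintegral_of_nonneg_ae (ae_of_all _ fun x => aux_kth_nonneg _ m hm hmn)
        hmm.aestronglyMeasurable,
      hd, lintegral_withDensity_eq_lintegral_mul _ (by fun_prop) hmm.ennreal_ofReal]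
    have : ∫⁻ x, (∏ i, ENNReal.ofReal (Z⁻¹ * (x i ^ β * Real.exp (-(x i ^ p))))) *
        ENNReal.ofReal (kthMax (fun i => x i / (∑ j, |x j| ^ p) ^ (1 / p)) m) ∂V
        = ENNReal.ofReal (Z⁻¹ ^ n) * T := by
      rw [hT, ← lintegral_const_mul' _ _ ENNReal.ofReal_ne_top]
      refine lintegral_congr_ae (hpos.mono fun x hx => ?_)
      have hS : 0 < ∑ i, x i ^ p :=
        Finset.sum_pos (fun i _ => rpow_pos_of_pos (hx i) p) ⟨⟨0, by omega⟩, Finset.mem_univ _⟩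
      have habs : ∀ i, |x i| = x i := fun i => abs_of_pos (hx i)
      simp only [habs]
      rw [hprod Z⁻¹ x (by positivity) hx]
      have : (fun i => x i / (∑ j, x j ^ p) ^ (1 / p)) = ((∑ j, x j ^ p) ^ (-(1 / p))) • x := by
        ext i
        rw [Pi.smul_apply, smul_eq_mul, rpow_neg hS.le, div_eq_inv_mul]
      rw [this, aux_kth_smul _ _ _ (by positivity), ENNReal.ofReal_mul (by positivity)]
      ring
    simp only [Pi.mul_apply]
    rw [this, ENNReal.toReal_mul, ENNReal.toReal_ofReal (by positivity)]
  have hm2 := congrArg ENNReal.toReal hmain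
  rw [ENNReal.toReal_mul, ENNReal.toReal_mul, ENNReal.toReal_ofReal hG4.le,
    ENNReal.toReal_ofReal hG3.le] at hm2
  rw [hL, hR, hZ]
  have hT' : T.toReal = Real.Gamma (n * (β + 1) / p) * J.toReal /
      Real.Gamma (n * (β + 1) / p + 1 / p) := by
    rw [eq_div_iff hG4.ne', ← hm2]; ring
  rw [hT', show c / p * Real.Gamma ((β + 1) / p) = c * (1 / p * Real.Gamma ((β + 1) / p)) by ring,
    mul_pow, inv_pow]
  have hcn : c ^ n ≠ 0 := by positivity
  have hzn : (1 / p * Real.Gamma ((β + 1) / p)) ^ n ≠ 0 := by positivity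
  generalize (1 / p * Real.Gamma ((β + 1) / p)) ^ n = A at *
  generalize c ^ n = B at *
  field_simp

end
end

section
/- Let 0<p<∞. There is a positive real number C_p^2 depending only on p such that for all integers n ≥ 2 and 1 ≤ m ≤ n, σ_{m−1}^{p,∞}(θ_{p,p/n−1}) ≤ C_p^2 · (Γ(n+1)/Γ(n−m+1)) · { Γ(n/p+n−m+1)/Γ(n/p+n+1) + (1/m!) · (e^{−1}/Γ(1/n))^m }. -/
open MeasureTheory Real Set
open scoped ENNReal

noncomputable section

lemma kth_set_bdd {n : ℕ} (x : Fin n → ℝ) {m : ℕ} (hm : 1 ≤ m) :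
    BddAbove {t : ℝ | ∃ S : Finset (Fin n), m ≤ S.card ∧ ∀ j ∈ S, t ≤ |x j|} := by
  refine ⟨∑ j, |x j|, ?_⟩
  rintro t ⟨S, hS, h⟩
  obtain ⟨j, hj⟩ : S.Nonempty := by
    rw [← Finset.card_pos]; omega
  exact (h j hj).trans (Finset.single_le_sum (f := fun j => |x j|) (fun i _ => abs_nonneg _) (Finset.mem_univ j))

lemma kth_set_zero {n : ℕ} (x : Fin n → ℝ) {m : ℕ} (hmn : m ≤ n) :
    (0 : ℝ) ∈ {t : ℝ | ∃ S : Finset (Fin n), m ≤ S.card ∧ ∀ j ∈ S, t ≤ |x j|} :=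
  ⟨Finset.univ, by simpa using hmn, fun j _ => abs_nonneg _⟩

lemma lt_kthMax_iff {n : ℕ} (x : Fin n → ℝ) {m : ℕ} (hm : 1 ≤ m) (hmn : m ≤ n) (t : ℝ) :
    t < kthMax x m ↔ ∃ S : Finset (Fin n), m ≤ S.card ∧ ∀ j ∈ S, t < |x j| := by
  unfold kthMax
  rw [lt_csSup_iff (kth_set_bdd x hm) ⟨0, kth_set_zero x hmn⟩]
  constructor
  · rintro ⟨s, ⟨S, hS, h⟩, hts⟩
    exact ⟨S, hS, fun j hj => hts.trans_le (h j hj)⟩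
  · rintro ⟨S, hS, h⟩
    have hne : S.Nonempty := by
      rw [← Finset.card_pos]; omega
    refine ⟨S.inf' hne (fun j => |x j|), ⟨S, hS, fun j hj => Finset.inf'_le _ hj⟩, ?_⟩
    rw [Finset.lt_inf'_iff]
    exact h

lemma kthMax_nonneg {n : ℕ} (x : Fin n → ℝ) {m : ℕ} (hm : 1 ≤ m) (hmn : m ≤ n) :
    0 ≤ kthMax x m := le_csSup (kth_set_bdd x hm) (kth_set_zero x hmn)

lemma kthMax_le {n : ℕ} (x : Fin n → ℝ) {m : ℕ} (hm : 1 ≤ m) (hmn : m ≤ n) {c : ℝ}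
    (h : ∀ j, |x j| ≤ c) : kthMax x m ≤ c := by
  by_contra! hc
  rw [lt_kthMax_iff x hm hmn] at hc
  obtain ⟨S, hS, hh⟩ := hc
  obtain ⟨j, hj⟩ : S.Nonempty := by
    rw [← Finset.card_pos]; omega
  exact absurd (h j) (not_le.2 (hh j hj))

lemma kthMax_smul {n : ℕ} (x : Fin n → ℝ) {m : ℕ} (hm : 1 ≤ m) (hmn : m ≤ n) {c : ℝ}
    (hc : 0 < c) : kthMax (fun i => x i / c) m * c = kthMax x m := by
  refine eq_of_forall_lt_iff fun t => ?_
  rw [← div_lt_iff₀ hc, lt_kthMax_iff _ hm hmn, lt_kthMax_iff _ hm hmn]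
  refine exists_congr fun S => and_congr_right fun _ => forall₂_congr fun j _ => ?_
  rw [abs_div, abs_of_pos hc, div_lt_div_iff_of_pos_right hc]

lemma measurable_kthMax {n m : ℕ} (hm : 1 ≤ m) (hmn : m ≤ n) :
    Measurable (fun x : Fin n → ℝ => kthMax x m) := by
  refine measurable_of_Ioi fun t => ?_
  have : (fun x : Fin n → ℝ => kthMax x m) ⁻¹' Ioi t =
      ⋃ S : Finset (Fin n), ⋃ _ : m ≤ S.card, ⋂ j ∈ S, {x | t < |x j|} := by
    ext x
    simp [lt_kthMax_iff x hm hmn]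
  rw [this]
  refine MeasurableSet.iUnion fun S => MeasurableSet.iUnion fun _ => ?_
  refine Finset.measurableSet_biInter _ fun j _ => ?_
  exact measurableSet_lt measurable_const (measurable_pi_apply j).abs

/-- the unnormalised density -/
def dens (p β t : ℝ) : ℝ := t ^ β * Real.exp (-(t ^ p))

lemma dens_nonneg (p β : ℝ) {t : ℝ} (ht : 0 < t) : 0 ≤ dens p β t := by
  unfold dens; positivity

lemma measurable_dens (p β : ℝ) : Measurable (dens p β) := by
  unfold dens; fun_prop

lemma dens_integrableOn {p β : ℝ} (hp : 0 < p) (hβ : -1 < β) :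
    IntegrableOn (dens p β) (Ioi 0) := integrableOn_rpow_mul_exp_neg_rpow hβ hp

lemma Z_eq {p : ℝ} (hp : 0 < p) {n : ℕ} (hn : 2 ≤ n) :
    ∫ s in Ioi (0 : ℝ), dens p (p / n - 1) s = 1 / p * Real.Gamma (1 / n) := by
  have hn0 : (0 : ℝ) < n := by positivity
  have := integral_rpow_mul_exp_neg_rpow hp (q := p / n - 1)
    (by have : 0 < p / n := by positivity
        linarith)
  unfold dens
  rw [this]
  congr 2
  field_simp
  ring

lemma Z_pos {p : ℝ} (hp : 0 < p) {n : ℕ} (hn : 2 ≤ n) :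
    0 < ∫ s in Ioi (0 : ℝ), dens p (p / n - 1) s := by
  rw [Z_eq hp hn]
  have hn0 : (0 : ℝ) < n := by positivity
  have := Real.Gamma_pos_of_pos (show (0 : ℝ) < 1 / n by positivity)
  positivity

lemma beta_gt {p : ℝ} (hp : 0 < p) {n : ℕ} (hn : 2 ≤ n) : -1 < p / n - 1 := by
  have hn0 : (0 : ℝ) < n := by positivity
  have : 0 < p / n := by positivity
  linarith

lemma gmeasure_apply {p β : ℝ} (hZ : 0 < ∫ s in Ioi (0 : ℝ), dens p β s)
    (hp : 0 < p) (hβ : -1 < β) {s : Set ℝ} (hs : MeasurableSet s) :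
    gmeasure p β s = ENNReal.ofReal ((∫ s in Ioi (0 : ℝ), dens p β s)⁻¹ *
      ∫ t in s ∩ Ioi 0, dens p β t) := by
  unfold gmeasure
  rw [withDensity_apply _ hs, Measure.restrict_restrict hs, ← integral_const_mul,
    ofReal_integral_eq_lintegral_ofReal]
  · rfl
  · exact ((dens_integrableOn hp hβ).mono_set inter_subset_right).const_mul _
  · rw [Filter.EventuallyLE, ae_restrict_iff' (hs.inter measurableSet_Ioi)]
    filter_upwards with t ht
    exact mul_nonneg (by positivity) (dens_nonneg p β ht.2)

lemma gmeasure_prob {p : ℝ} (hp : 0 < p) {n : ℕ} (hn : 2 ≤ n) :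
    IsProbabilityMeasure (gmeasure p (p / n - 1)) := by
  constructor
  rw [gmeasure_apply (Z_pos hp hn) hp (beta_gt hp hn) MeasurableSet.univ, univ_inter,
    inv_mul_cancel₀ (Z_pos hp hn).ne', ENNReal.ofReal_one]

/-- `∫_t^∞ s^(p-1) e^{-s^p} ds = e^{-t^p}/p`. -/
lemma tail_aux {p : ℝ} (hp : 0 < p) {t : ℝ} (ht : 0 < t) :
    IntegrableOn (fun s => dens p (p - 1) s) (Ioi t) ∧
    ∫ s in Ioi t, dens p (p - 1) s = Real.exp (-(t ^ p)) / p := by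
  refine ⟨(dens_integrableOn hp (by linarith)).mono_set (Ioi_subset_Ioi ht.le), ?_⟩
  have h := integral_Ioi_of_hasDerivAt_of_tendsto' (f := fun s => - (Real.exp (-(s ^ p)) / p))
    (f' := dens p (p - 1)) (a := t) (m := 0) ?_
    ((dens_integrableOn hp (by linarith)).mono_set (Ioi_subset_Ioi ht.le)) ?_
  · rw [h]; ring
  · intro x hx
    have hx0 : 0 < x := ht.trans_le hx
    have h1 : HasDerivAt (fun s : ℝ => -(Real.exp (-(s ^ p)) / p))
        (-(Real.exp (-(x ^ p)) * -(p * x ^ (p - 1)) / p)) x :=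
      ((Real.hasDerivAt_rpow_const (x := x) (p := p) (Or.inl hx0.ne')).neg.exp.div_const p).neg
    have h2 : dens p (p - 1) x = -(Real.exp (-(x ^ p)) * -(p * x ^ (p - 1)) / p) := by
      unfold dens
      field_simp
    rw [h2]
    exact h1
  · have h1 : Filter.Tendsto (fun s : ℝ => Real.exp (-(s ^ p))) Filter.atTop (nhds 0) :=
      Real.tendsto_exp_neg_atTop_nhds_zero.comp (tendsto_rpow_atTop hp)
    simpa using (h1.div_const p).neg

lemma tail_le {p : ℝ} (hp : 0 < p) {n : ℕ} (hn : 2 ≤ n) {t : ℝ} (ht : 1 ≤ t) :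
    ∫ s in Ioi t, dens p (p / n - 1) s ≤ Real.exp (-(t ^ p)) / p := by
  have ht0 : 0 < t := by linarith
  rw [← (tail_aux hp ht0).2]
  refine setIntegral_mono_on ((dens_integrableOn hp (beta_gt hp hn)).mono_set (Ioi_subset_Ioi ht0.le))
    (tail_aux hp ht0).1 measurableSet_Ioi fun s hs => ?_
  unfold dens
  have hs1 : 1 ≤ s := ht.trans (le_of_lt hs)
  have hn1 : (1 : ℝ) ≤ n := by exact_mod_cast (by omega : 1 ≤ n)
  gcongr
  · exact div_le_self hp.le hn1

lemma q_tail {p : ℝ} (hp : 0 < p) {n : ℕ} (hn : 2 ≤ n) {t : ℝ} (ht : 1 ≤ t) :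
    gmeasure p (p / n - 1) {x | t < |x|} ≤
      ENNReal.ofReal (Real.exp (-(t ^ p)) / Real.Gamma (1 / n)) := by
  have hm : MeasurableSet {x : ℝ | t < |x|} := measurableSet_lt measurable_const measurable_id.abs
  rw [gmeasure_apply (Z_pos hp hn) hp (beta_gt hp hn) hm]
  have hset : {x : ℝ | t < |x|} ∩ Ioi 0 = Ioi t := by
    ext x
    simp only [mem_inter_iff, mem_ofPred_eq, mem_Ioi]
    constructor
    · rintro ⟨h1, h2⟩; rwa [abs_of_pos h2] at h1
    · intro h
      have : 0 < x := by linarith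
      exact ⟨by rwa [abs_of_pos this], this⟩
  rw [hset, Z_eq hp hn]
  apply ENNReal.ofReal_le_ofReal
  have hG := Real.Gamma_pos_of_pos (show (0 : ℝ) < 1 / n by positivity)
  calc _ ≤ (1 / p * Real.Gamma (1 / n))⁻¹ * (Real.exp (-(t ^ p)) / p) := by
        gcongr
        exact tail_le hp hn ht
    _ = _ := by field_simp

lemma head_one {p : ℝ} (hp : 0 < p) {n : ℕ} (hn : 2 ≤ n) :
    Real.exp (-1) * n / p ≤ ∫ s in Ioc (0:ℝ) 1, dens p (p / n - 1) s := by
  have hn0 : (0 : ℝ) < n := by positivity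
  have h1 : ∫ s in Ioc (0:ℝ) 1, Real.exp (-1) * s ^ (p / n - 1) = Real.exp (-1) * n / p := by
    rw [integral_const_mul, ← intervalIntegral.integral_of_le zero_le_one,
      integral_rpow (Or.inl (beta_gt hp hn)), sub_add_cancel, Real.one_rpow,
      Real.zero_rpow (by positivity)]
    field_simp
    ring
  rw [← h1]
  refine setIntegral_mono_on ?_
    ((dens_integrableOn hp (beta_gt hp hn)).mono_set Ioc_subset_Ioi_self) measurableSet_Ioc
    fun s hs => ?_
  · refine Integrable.const_mul ?_ _
    have := (intervalIntegral.intervalIntegrable_rpow' (a := 0) (b := 1) (beta_gt hp hn))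
    rwa [intervalIntegrable_iff_integrableOn_Ioc_of_le zero_le_one] at this
  · unfold dens
    rw [mul_comm]
    have : s ^ p ≤ 1 := Real.rpow_le_one hs.1.le hs.2 hp.le
    have := hs.1
    gcongr

lemma head_scale {p : ℝ} (hp : 0 < p) {n : ℕ} (hn : 2 ≤ n) {t : ℝ} (ht : 0 < t) (ht1 : t ≤ 1) :
    t ^ (p / n) * ∫ s in Ioc (0:ℝ) 1, dens p (p / n - 1) s ≤
      ∫ s in Ioc (0:ℝ) t, dens p (p / n - 1) s := by
  have h1 := intervalIntegral.smul_integral_comp_mul_left (a := 0) (b := 1) (dens p (p / n - 1)) t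
  simp only [mul_zero, mul_one] at h1
  rw [← intervalIntegral.integral_of_le ht.le, ← h1, ← intervalIntegral.integral_of_le zero_le_one,
    ← intervalIntegral.integral_const_mul, smul_eq_mul, ← intervalIntegral.integral_const_mul,
    intervalIntegral.integral_of_le zero_le_one, intervalIntegral.integral_of_le zero_le_one]
  have hint : IntegrableOn (dens p (p / n - 1)) (Ioc 0 1) :=
    (dens_integrableOn hp (beta_gt hp hn)).mono_set Ioc_subset_Ioi_self
  refine setIntegral_mono_on (hint.const_mul _) ?_ measurableSet_Ioc
    fun s hs => ?_
  · refine Integrable.const_mul ?_ _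
    have h2 : IntervalIntegrable (dens p (p / n - 1)) volume 0 t := by
      rw [intervalIntegrable_iff_integrableOn_Ioc_of_le ht.le]
      exact (dens_integrableOn hp (beta_gt hp hn)).mono_set Ioc_subset_Ioi_self
    have h3 := h2.comp_mul_left (c := t)
    rw [zero_div, div_self ht.ne', intervalIntegrable_iff_integrableOn_Ioc_of_le zero_le_one] at h3
    exact h3
  · unfold dens
    have hs0 := hs.1
    rw [Real.mul_rpow ht.le hs0.le, Real.mul_rpow ht.le hs0.le]
    have e1 : t ^ (p / n) = t * t ^ (p / n - 1) := by
      rw [Real.rpow_sub_one ht.ne']; field_simp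
    have : t ^ p ≤ 1 := Real.rpow_le_one ht.le ht1 hp.le
    have h4 : t ^ p * s ^ p ≤ s ^ p := mul_le_of_le_one_left (by positivity) this
    calc t ^ (p / n) * (s ^ (p / n - 1) * Real.exp (-(s ^ p)))
        = t * (t ^ (p / n - 1) * s ^ (p / n - 1) * Real.exp (-(s ^ p))) := by rw [e1]; ring
      _ ≤ _ := by gcongr

lemma q_head {p : ℝ} (hp : 0 < p) {n : ℕ} (hn : 2 ≤ n) {t : ℝ} (ht : 0 < t) (ht1 : t ≤ 1) :
    (t / Real.exp (1 / p)) ^ (p / n) ≤ (gmeasure p (p / n - 1)).real {x | t < |x|}ᶜ := by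
  have hn0 : (0 : ℝ) < n := by positivity
  have hm : MeasurableSet {x : ℝ | t < |x|}ᶜ :=
    (measurableSet_lt measurable_const measurable_id.abs).compl
  have hset : {x : ℝ | t < |x|}ᶜ ∩ Ioi 0 = Ioc 0 t := by
    ext x
    simp only [mem_inter_iff, mem_compl_iff, mem_ofPred_eq, mem_Ioi, mem_Ioc, not_lt]
    constructor
    · rintro ⟨h1, h2⟩; rw [abs_of_pos h2] at h1; exact ⟨h2, h1⟩
    · rintro ⟨h1, h2⟩
      exact ⟨by rwa [abs_of_pos h1], h1⟩
  have hZ := Z_pos hp hn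
  have hH0 : 0 ≤ ∫ s in Ioc (0:ℝ) t, dens p (p / n - 1) s :=
    setIntegral_nonneg measurableSet_Ioc fun s hs => dens_nonneg _ _ hs.1
  rw [Measure.real, gmeasure_apply hZ hp (beta_gt hp hn) hm, hset,
    ENNReal.toReal_ofReal (by positivity)]
  have hH1 := head_one hp hn
  have hsc := head_scale hp hn ht ht1
  have htl := tail_le hp hn (le_refl 1)
  rw [Real.one_rpow] at htl
  have hint := dens_integrableOn hp (beta_gt hp hn)
  have hsplit : ∫ s in Ioi (0 : ℝ), dens p (p / n - 1) s =
      (∫ s in Ioc (0:ℝ) 1, dens p (p / n - 1) s) + ∫ s in Ioi (1:ℝ), dens p (p / n - 1) s := by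
    rw [← Ioc_union_Ioi_eq_Ioi (zero_le_one' ℝ), setIntegral_union]
    · exact Ioc_disjoint_Ioi le_rfl
    · exact measurableSet_Ioi
    · exact hint.mono_set Ioc_subset_Ioi_self
    · exact hint.mono_set (Ioi_subset_Ioi zero_le_one)
  set H1 := ∫ s in Ioc (0:ℝ) 1, dens p (p / n - 1) s
  set Ht := ∫ s in Ioc (0:ℝ) t, dens p (p / n - 1) s
  set Z := ∫ s in Ioi (0 : ℝ), dens p (p / n - 1) s
  set T := ∫ s in Ioi (1:ℝ), dens p (p / n - 1) s
  have hTH : n * T ≤ H1 := by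
    calc n * T ≤ n * (Real.exp (-1) / p) := by gcongr
      _ = Real.exp (-1) * n / p := by ring
      _ ≤ H1 := hH1
  have hexp : Real.exp (-(1 / n)) ≤ n / (n + 1) := by
    rw [Real.exp_neg, inv_le_comm₀ (Real.exp_pos _) (by positivity), inv_div]
    have := Real.add_one_le_exp (1 / (n : ℝ))
    calc ((n : ℝ) + 1) / n = 1 / n + 1 := by field_simp; ring
      _ ≤ _ := this
  have hH1Z : n / (n + 1) * Z ≤ H1 := by
    rw [div_mul_eq_mul_div, div_le_iff₀ (by positivity), hsplit]
    nlinarith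
  have e1 : (t / Real.exp (1 / p)) ^ (p / n) = t ^ (p / n) * Real.exp (-(1 / n)) := by
    rw [Real.div_rpow ht.le (Real.exp_pos _).le, ← Real.exp_mul, Real.exp_neg, div_eq_mul_inv]
    congr 3
    field_simp
  rw [e1, inv_mul_eq_div, le_div_iff₀ hZ]
  calc t ^ (p / n) * Real.exp (-(1 / n)) * Z ≤ t ^ (p / n) * (n / (n + 1)) * Z := by gcongr
    _ = t ^ (p / n) * (n / (n + 1) * Z) := by ring
    _ ≤ t ^ (p / n) * H1 := by gcongr
    _ ≤ Ht := hsc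

lemma lintegral_gmeasure (p β : ℝ) (f : ℝ → ℝ≥0∞) (hf : Measurable f) :
    ∫⁻ t, f t ∂(gmeasure p β) = ∫⁻ t, (Ioi (0:ℝ)).indicator (fun t => ENNReal.ofReal
      ((∫ s in Ioi (0 : ℝ), dens p β s)⁻¹ * dens p β t)) t * f t := by
  have hm : Measurable (fun t => ENNReal.ofReal
      ((∫ s in Ioi (0 : ℝ), dens p β s)⁻¹ * dens p β t)) :=
    ((measurable_dens p β).const_mul _).ennreal_ofReal
  have : gmeasure p β = volume.withDensity ((Ioi (0:ℝ)).indicator (fun t => ENNReal.ofReal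
      ((∫ s in Ioi (0 : ℝ), dens p β s)⁻¹ * dens p β t))) := by
    rw [withDensity_indicator measurableSet_Ioi]; rfl
  rw [this, lintegral_withDensity_eq_lintegral_mul _ (hm.indicator measurableSet_Ioi) hf]
  rfl

lemma lintegral_scale {c : ℝ} (hc : 0 < c) (h : ℝ → ℝ≥0∞) (hh : Measurable h) :
    ∫⁻ t, h t = ENNReal.ofReal c * ∫⁻ u, h (c * u) := by
  conv_lhs => rw [← Real.smul_map_volume_mul_left hc.ne']
  rw [lintegral_smul_measure, lintegral_map hh (measurable_const_mul c), abs_of_pos hc, smul_eq_mul]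

lemma nu_scale {p β c k : ℝ} (hc : 0 < c) (hck : (1 + k) * c ^ p = 1) {s : Set ℝ}
    (hs : MeasurableSet s) (hZ : 0 < ∫ s in Ioi (0 : ℝ), dens p β s) :
    ∫⁻ t, s.indicator (fun t => ENNReal.ofReal (Real.exp (-(k * |t| ^ p)))) t ∂(gmeasure p β) =
      ENNReal.ofReal (c ^ (β + 1)) * gmeasure p β ((fun t => c * t) ⁻¹' s) := by
  have hE : Measurable (fun t : ℝ => ENNReal.ofReal (Real.exp (-(k * |t| ^ p)))) := by fun_prop
  have hm : Measurable (fun t => ENNReal.ofReal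
      ((∫ s in Ioi (0 : ℝ), dens p β s)⁻¹ * dens p β t)) :=
    ((measurable_dens p β).const_mul _).ennreal_ofReal
  have hs' : MeasurableSet ((fun t => c * t) ⁻¹' s) := measurable_const_mul c hs
  rw [lintegral_gmeasure _ _ _ (hE.indicator hs), ← lintegral_indicator_one hs',
    lintegral_gmeasure _ _ _ (measurable_one.indicator hs'), lintegral_scale hc,
    ← lintegral_const_mul, ← lintegral_const_mul]
  · refine lintegral_congr fun u => ?_
    by_cases hu : 0 < u
    · by_cases hus : c * u ∈ s
      · have h1 : c * u ∈ Ioi (0:ℝ) := mul_pos hc hu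
        have h2 : u ∈ (fun t => c * t) ⁻¹' s := hus
        rw [indicator_of_mem h1, indicator_of_mem hus, indicator_of_mem h2,
          indicator_of_mem (show u ∈ Ioi (0:ℝ) from hu), Pi.one_apply, mul_one,
          ← ENNReal.ofReal_mul (by have := dens_nonneg p β h1; positivity),
          ← ENNReal.ofReal_mul hc.le, ← ENNReal.ofReal_mul (by positivity)]
        congr 1
        unfold dens
        rw [abs_of_pos h1, Real.mul_rpow hc.le hu.le, Real.mul_rpow hc.le hu.le,
          Real.rpow_add_one hc.ne']
        have : Real.exp (-(u ^ p)) =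
            Real.exp (-(c ^ p * u ^ p)) * Real.exp (-(k * (c ^ p * u ^ p))) := by
          rw [← Real.exp_add]
          congr 1
          linear_combination (u ^ p) * hck
        rw [this]
        ring
      · have h2 : u ∉ (fun t => c * t) ⁻¹' s := hus
        rw [indicator_of_notMem hus, indicator_of_notMem h2]
        simp
    · have h1 : c * u ∉ Ioi (0:ℝ) := by
        simp only [mem_Ioi, not_lt]
        exact mul_nonpos_of_nonneg_of_nonpos hc.le (not_lt.1 hu)
      rw [indicator_of_notMem h1, indicator_of_notMem (show u ∉ Ioi (0:ℝ) from hu)]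
      simp
  · exact (hm.indicator measurableSet_Ioi).mul (measurable_one.indicator hs')
  · exact ((hm.indicator measurableSet_Ioi).mul (hE.indicator hs)).comp (measurable_const_mul c)
  · exact (hm.indicator measurableSet_Ioi).mul (hE.indicator hs)

lemma pi_scale {n : ℕ} (ν : Measure ℝ) [IsProbabilityMeasure ν] (f : ℝ → ℝ≥0∞) (hf : Measurable f)
    (hf1 : ∀ t, f t ≤ 1)
    (a : ℝ≥0∞) (c : ℝ)
    (h : ∀ s, MeasurableSet s → ∫⁻ t, s.indicator f t ∂ν = a * ν ((fun t => c * t) ⁻¹' s))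
    (Φ : (Fin n → ℝ) → ℝ≥0∞) (hΦ : Measurable Φ) :
    ∫⁻ ω, (∏ i, f (ω i)) * Φ ω ∂(Measure.pi fun _ : Fin n => ν) =
      a ^ n * ∫⁻ ω, Φ (fun i => c * ω i) ∂(Measure.pi fun _ : Fin n => ν) := by
  have hprod : Measurable (fun ω : Fin n → ℝ => ∏ i, f (ω i)) :=
    Finset.measurable_prod _ fun i _ => hf.comp (measurable_pi_apply i)
  have hsc : Measurable (fun (ω : Fin n → ℝ) i => c * ω i) := by fun_prop
  have hfin : IsFiniteMeasure (ν.withDensity f) := by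
    refine isFiniteMeasure_withDensity ?_
    refine ne_of_lt ?_
    calc ∫⁻ t, f t ∂ν ≤ ∫⁻ t, 1 ∂ν := lintegral_mono hf1
      _ < ⊤ := by simp
  have e1 : (Measure.pi fun _ : Fin n => ν.withDensity f) =
      (Measure.pi fun _ : Fin n => ν).withDensity (fun ω => ∏ i, f (ω i)) := by
    refine Measure.pi_eq fun s hs => ?_
    rw [withDensity_apply _ (MeasurableSet.univ_pi hs), ← lintegral_indicator (MeasurableSet.univ_pi hs)]
    have : ∀ ω : Fin n → ℝ, (univ.pi s).indicator (fun ω => ∏ i, f (ω i)) ω =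
        ∏ i, (s i).indicator f (ω i) := by
      intro ω
      by_cases hω : ω ∈ univ.pi s
      · rw [indicator_of_mem hω]
        refine Finset.prod_congr rfl fun i _ => ?_
        rw [indicator_of_mem (hω i (mem_univ i))]
      · rw [indicator_of_notMem hω]
        simp only [mem_univ_pi, not_forall] at hω
        obtain ⟨i, hi⟩ := hω
        exact (Finset.prod_eq_zero (Finset.mem_univ i) (indicator_of_notMem hi _)).symm
    simp_rw [this]
    rw [ProbabilityTheory.lintegral_prod_eq_prod_lintegral_of_indepFun Finset.univ
      (fun i (ω : Fin n → ℝ) => (s i).indicator f (ω i))]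
    · refine Finset.prod_congr rfl fun i _ => ?_
      rw [withDensity_apply _ (hs i), ← lintegral_indicator (hs i)]
      exact ((measurePreserving_eval (fun _ : Fin n => ν) i).lintegral_comp
        (hf.indicator (hs i)))
    · exact ProbabilityTheory.iIndepFun_pi (X := fun i => (s i).indicator f)
        (fun i => (hf.indicator (hs i)).aemeasurable)
    · intro i
      exact (hf.indicator (hs i)).comp (measurable_pi_apply i)
  have e2 : (Measure.pi fun _ : Fin n => ν.withDensity f) =
      a ^ n • (Measure.pi fun _ : Fin n => ν).map (fun ω i => c * ω i) := by
    refine Measure.pi_eq fun s hs => ?_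
    rw [Measure.smul_apply, Measure.map_apply hsc (MeasurableSet.univ_pi hs)]
    have : (fun (ω : Fin n → ℝ) i => c * ω i) ⁻¹' (univ.pi s) =
      univ.pi (fun i => (fun t => c * t) ⁻¹' (s i)) := by
      ext ω; simp
    rw [this, Measure.pi_pi, smul_eq_mul]
    have : ∀ i, (ν.withDensity f) (s i) = a * ν ((fun t => c * t) ⁻¹' (s i)) := by
      intro i
      rw [withDensity_apply _ (hs i), ← lintegral_indicator (hs i), h _ (hs i)]
    simp_rw [this]
    rw [Finset.prod_mul_distrib]
    simp
  have := lintegral_withDensity_eq_lintegral_mul (Measure.pi fun _ : Fin n => ν) hprod hΦ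
  simp only [Pi.mul_apply] at this
  rw [← this, ← e1, e2, lintegral_smul_measure, lintegral_map hΦ hsc, smul_eq_mul]

lemma pi_atleast {n m : ℕ} (ν : Measure ℝ) [IsProbabilityMeasure ν] {A : Set ℝ}
    (hA : MeasurableSet A) :
    (Measure.pi fun _ : Fin n => ν) {ω | ∃ S : Finset (Fin n), m ≤ S.card ∧ ∀ j ∈ S, ω j ∈ A} ≤
      ENNReal.ofReal (∑ k ∈ Finset.Ico m (n + 1),
        (bernsteinPolynomial ℝ n k).eval (ν.real A)) := by
  classical
  set q := ν.real A with hq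
  have hq0 : 0 ≤ q := measureReal_nonneg
  have hq1 : q ≤ 1 := measureReal_le_one
  have hνA : ν A = ENNReal.ofReal q := by simp [hq]
  have hνAc : ν Aᶜ = ENNReal.ofReal (1 - q) := by
    rw [← probReal_compl_eq_one_sub hA]; simp
  set g : ℕ → ℝ := fun k => q ^ k * (1 - q) ^ (n - k) with hg
  have hg0 : ∀ k, 0 ≤ g k := fun k => mul_nonneg (pow_nonneg hq0 _) (pow_nonneg (by linarith) _)
  have hsub : {ω : Fin n → ℝ | ∃ S : Finset (Fin n), m ≤ S.card ∧ ∀ j ∈ S, ω j ∈ A} ⊆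
      ⋃ S ∈ (Finset.univ : Finset (Finset (Fin n))).filter (fun S => m ≤ S.card),
        univ.pi (fun j => if j ∈ S then A else Aᶜ) := by
    rintro ω ⟨S, hS, h⟩
    simp only [Finset.mem_filter, Finset.mem_univ, true_and, mem_iUnion]
    refine ⟨Finset.univ.filter (fun j => ω j ∈ A), hS.trans (Finset.card_le_card ?_), ?_⟩
    · intro j hj
      simpa using h j hj
    · intro j _
      by_cases hj : ω j ∈ A <;> simp [hj]
  have hbox : ∀ S : Finset (Fin n), (Measure.pi fun _ : Fin n => ν)
      (univ.pi (fun j => if j ∈ S then A else Aᶜ)) = ENNReal.ofReal (g S.card) := by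
    intro S
    rw [Measure.pi_pi]
    have : ∀ j, ν (if j ∈ S then A else Aᶜ) = ENNReal.ofReal (if j ∈ S then q else 1 - q) := by
      intro j
      split_ifs <;> assumption
    simp_rw [this]
    rw [← ENNReal.ofReal_prod_of_nonneg]
    · congr 1
      rw [Finset.prod_ite]
      simp only [Finset.prod_const, hg]
      congr 2
      · simp
      · rw [Finset.filter_not, Finset.card_sdiff_of_subset (Finset.filter_subset _ _)]
        simp
    · intro j _
      split_ifs <;> linarith
  calc _ ≤ _ := measure_mono hsub
    _ ≤ _ := measure_biUnion_finset_le _ _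
    _ = ∑ S : Finset (Fin n) with m ≤ S.card, ENNReal.ofReal (g S.card) :=
        Finset.sum_congr rfl fun S _ => hbox S
    _ = ENNReal.ofReal (∑ S : Finset (Fin n) with m ≤ S.card, g S.card) :=
        (ENNReal.ofReal_sum_of_nonneg fun S _ => hg0 _).symm
    _ = _ := by
        congr 1
        rw [Finset.sum_filter]
        have := Finset.sum_powerset_apply_card (fun k => if m ≤ k then g k else 0)
          (x := (Finset.univ : Finset (Fin n)))
        rw [Finset.powerset_univ] at this
        rw [this, Finset.card_univ, Fintype.card_fin]
        have hI : Finset.Ico m (n + 1) = (Finset.range (n + 1)).filter (fun k => m ≤ k) := by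
          ext k; simp; omega
        rw [hI, Finset.sum_filter]
        refine Finset.sum_congr rfl fun k _ => ?_
        split_ifs
        · simp [bernsteinPolynomial, hg, mul_assoc]
        · simp

lemma bern_sum_deriv (n m : ℕ) (hmn : m ≤ n) :
    Polynomial.derivative (∑ k ∈ Finset.Ico (m + 1) (n + 1 + 1), bernsteinPolynomial ℝ (n + 1) k) =
      ((n + 1 : ℕ) : Polynomial ℝ) * bernsteinPolynomial ℝ n m := by
  have hind : ∀ N, m ≤ N → Polynomial.derivative
      (∑ k ∈ Finset.Ico (m + 1) (N + 1), bernsteinPolynomial ℝ (n + 1) k) =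
      ((n + 1 : ℕ) : Polynomial ℝ) * (bernsteinPolynomial ℝ n m - bernsteinPolynomial ℝ n N) := by
    intro N hN
    induction N, hN using Nat.le_induction with
    | base => simp
    | succ N hN ih =>
      rw [Finset.sum_Ico_succ_top (by omega), Polynomial.derivative_add, ih,
        bernsteinPolynomial.derivative_succ]
      simp only [Nat.add_sub_cancel]
      ring
  rw [hind (n + 1) (by omega), bernsteinPolynomial.eq_zero_of_lt ℝ (by omega : n < n + 1), sub_zero]

lemma bern_sum_eq (n m : ℕ) (hmn : m ≤ n) (q : ℝ) :
    ∑ k ∈ Finset.Ico (m + 1) (n + 1 + 1), (bernsteinPolynomial ℝ (n + 1) k).eval q =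
      ∫ r in (0:ℝ)..q, ((n + 1 : ℕ) : ℝ) * (bernsteinPolynomial ℝ n m).eval r := by
  set P := ∑ k ∈ Finset.Ico (m + 1) (n + 1 + 1), bernsteinPolynomial ℝ (n + 1) k with hP
  have hd : ∀ r, HasDerivAt (fun r => P.eval r)
      (((n + 1 : ℕ) : ℝ) * (bernsteinPolynomial ℝ n m).eval r) r := by
    intro r
    have := P.hasDerivAt r
    rw [hP, bern_sum_deriv n m hmn, ← hP] at this
    simpa using this
  rw [intervalIntegral.integral_eq_sub_of_hasDerivAt (fun r _ => hd r)]
  · have h0 : P.eval 0 = 0 := by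
      rw [hP, Polynomial.eval_finsetSum]
      refine Finset.sum_eq_zero fun k hk => ?_
      rw [bernsteinPolynomial.eval_at_0, if_neg]
      have := (Finset.mem_Ico.1 hk).1
      omega
    rw [h0, sub_zero, hP, Polynomial.eval_finsetSum]
  · apply Continuous.intervalIntegrable
    exact continuous_const.mul (bernsteinPolynomial ℝ n m).continuous

lemma bern_nonneg (n m : ℕ) {r : ℝ} (h0 : 0 ≤ r) (h1 : r ≤ 1) :
    0 ≤ (bernsteinPolynomial ℝ n m).eval r := by
  have : 0 ≤ 1 - r := by linarith
  simp only [bernsteinPolynomial, Polynomial.eval_mul, Polynomial.eval_pow, Polynomial.eval_sub,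
    Polynomial.eval_one, Polynomial.eval_X, Polynomial.eval_natCast]
  positivity

lemma pi_atleast' {n m : ℕ} (hmn : m ≤ n) (ν : Measure ℝ) [IsProbabilityMeasure ν] {A : Set ℝ}
    (hA : MeasurableSet A) :
    (Measure.pi fun _ : Fin (n + 1) => ν)
      {ω | ∃ S : Finset (Fin (n + 1)), m + 1 ≤ S.card ∧ ∀ j ∈ S, ω j ∈ A} ≤
      ∫⁻ r in Ioo (0:ℝ) (ν.real A),
        ENNReal.ofReal (((n + 1 : ℕ) : ℝ) * (bernsteinPolynomial ℝ n m).eval r) := by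
  refine (pi_atleast ν hA).trans ?_
  have hq0 : 0 ≤ ν.real A := measureReal_nonneg
  have hq1 : ν.real A ≤ 1 := measureReal_le_one
  rw [bern_sum_eq n m hmn, intervalIntegral.integral_of_le hq0, integral_Ioc_eq_integral_Ioo,
    ofReal_integral_eq_lintegral_ofReal]
  · refine Continuous.integrableOn_Icc ?_ |>.mono_set Ioo_subset_Icc_self
    exact continuous_const.mul (bernsteinPolynomial ℝ n m).continuous
  · rw [Filter.EventuallyLE, ae_restrict_iff' measurableSet_Ioo]
    filter_upwards with r hr
    exact mul_nonneg (by positivity) (bern_nonneg n m hr.1.le (hr.2.le.trans hq1))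

lemma beta_lint {α β : ℝ} (hα : 0 < α) (hβ : 0 < β) :
    ∫⁻ x in Ioo (0:ℝ) 1, ENNReal.ofReal (x ^ (α - 1) * (1 - x) ^ (β - 1)) =
      ENNReal.ofReal (ProbabilityTheory.beta α β) := by
  have hb := ProbabilityTheory.beta_pos hα hβ
  have h := ProbabilityTheory.lintegral_betaPDF_eq_one hα hβ
  rw [ProbabilityTheory.lintegral_betaPDF] at h
  rw [← mul_one (ENNReal.ofReal _), ← h, ← lintegral_const_mul _ (by fun_prop)]
  refine lintegral_congr fun x => ?_
  rw [← ENNReal.ofReal_mul hb.le]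
  congr 1
  field_simp

lemma head_int {p : ℝ} (hp : 0 < p) {n m : ℕ} (hmn : m ≤ n) (hn : 1 ≤ n) :
    ∫⁻ t in Ioc (0:ℝ) 1, (Measure.pi fun _ : Fin (n + 1) => gmeasure p (p / (n + 1 : ℕ) - 1))
      {ω | ∃ S : Finset (Fin (n + 1)), m + 1 ≤ S.card ∧ ∀ j ∈ S, ω j ∈ {x | t < |x|}} ≤
    ENNReal.ofReal (Real.exp (1 / p) * (((n + 1 : ℕ) : ℝ) * (n.choose m) *
      ProbabilityTheory.beta (m + 1) (n - m + (n + 1 : ℕ) / p + 1))) := by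
  set N : ℕ := n + 1 with hN
  set c := Real.exp (1 / p) with hc
  have hc0 : 0 < c := Real.exp_pos _
  have := gmeasure_prob hp (n := N) (by omega)
  set ν := gmeasure p (p / N - 1) with hν
  have hN0 : (0:ℝ) < N := by positivity
  set w : ℝ → ℝ≥0∞ := fun r => ENNReal.ofReal ((N : ℝ) * (bernsteinPolynomial ℝ n m).eval r) with hw
  have hwm : Measurable w := by
    have := (bernsteinPolynomial ℝ n m).continuous.measurable
    exact (this.const_mul _).ennreal_ofReal
  have hstep : ∀ t ∈ Ioc (0:ℝ) 1, (Measure.pi fun _ : Fin (n + 1) => ν)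
      {ω | ∃ S : Finset (Fin (n + 1)), m + 1 ≤ S.card ∧ ∀ j ∈ S, ω j ∈ {x | t < |x|}} ≤
      ∫⁻ r in Ioo (0:ℝ) 1, (if t < c * (1 - r) ^ (N / p) then w r else 0) := by
    intro t ht
    have hA : MeasurableSet {x : ℝ | t < |x|} := measurableSet_lt measurable_const measurable_id.abs
    refine (pi_atleast' hmn ν hA).trans ?_
    have hq := q_head hp (n := N) (by omega) ht.1 ht.2
    rw [← hν, ← hc, probReal_compl_eq_one_sub hA] at hq
    have hq1 : ν.real {x | t < |x|} ≤ 1 := measureReal_le_one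
    rw [← lintegral_indicator measurableSet_Ioo, ← lintegral_indicator measurableSet_Ioo]
    refine lintegral_mono fun r => ?_
    by_cases hr : r ∈ Ioo 0 (ν.real {x | t < |x|})
    · have hr1 : r ∈ Ioo (0:ℝ) 1 := ⟨hr.1, hr.2.trans_le hq1⟩
      rw [indicator_of_mem hr, indicator_of_mem hr1, if_pos]
      have h1 : (t / c) ^ (p / N) < 1 - r := by linarith [hr.2]
      have htc : 0 < t / c := div_pos ht.1 hc0
      have h2 := Real.rpow_lt_rpow (by positivity) h1 (show 0 < N / p by positivity)
      rw [← Real.rpow_mul htc.le, show p / N * (N / p) = 1 by field_simp, Real.rpow_one,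
        div_lt_iff₀ hc0] at h2
      linarith
    · rw [indicator_of_notMem hr]
      exact zero_le
  have hmeas : Measurable (Function.uncurry fun (t r : ℝ) =>
      (if t < c * (1 - r) ^ (N / p) then w r else 0)) := by
    refine Measurable.ite ?_ (hwm.comp measurable_snd) measurable_const
    exact measurableSet_lt measurable_fst (by fun_prop)
  calc _ ≤ ∫⁻ t in Ioc (0:ℝ) 1, ∫⁻ r in Ioo (0:ℝ) 1,
        (if t < c * (1 - r) ^ (N / p) then w r else 0) :=
        setLIntegral_mono' measurableSet_Ioc hstep
    _ = ∫⁻ r in Ioo (0:ℝ) 1, ∫⁻ t in Ioc (0:ℝ) 1,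
        (if t < c * (1 - r) ^ (N / p) then w r else 0) := lintegral_lintegral_swap hmeas.aemeasurable
    _ ≤ ∫⁻ r in Ioo (0:ℝ) 1, ENNReal.ofReal (c * (N * n.choose m)) * ENNReal.ofReal
          (r ^ (((m + 1 : ℝ)) - 1) * (1 - r) ^ ((n - m + N / p + 1 : ℝ) - 1)) := by
        refine setLIntegral_mono' measurableSet_Ioo fun r hr => ?_
        have h1r : 0 < 1 - r := by linarith [hr.2]
        calc _ ≤ ∫⁻ t in Ioi (0:ℝ), (Iio (c * (1 - r) ^ (N / p))).indicator (fun _ => w r) t := by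
              refine (lintegral_mono_set Ioc_subset_Ioi_self).trans_eq ?_
              refine lintegral_congr fun t => ?_
              simp [indicator]
          _ = w r * ENNReal.ofReal (c * (1 - r) ^ (N / p)) := by
              rw [lintegral_indicator measurableSet_Iio, Measure.restrict_restrict measurableSet_Iio,
                setLIntegral_const, Iio_inter_Ioi, Real.volume_Ioo, sub_zero]
          _ = _ := by
              rw [hw]
              have hb := bern_nonneg n m hr.1.le hr.2.le
              rw [← ENNReal.ofReal_mul (by positivity), ← ENNReal.ofReal_mul (by positivity)]
              congr 1
              simp only [bernsteinPolynomial, Polynomial.eval_mul, Polynomial.eval_pow,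
                Polynomial.eval_sub, Polynomial.eval_one, Polynomial.eval_X,
                Polynomial.eval_natCast]
              rw [add_sub_cancel_right, add_sub_cancel_right, Real.rpow_add h1r,
                Real.rpow_natCast, ← Nat.cast_sub hmn, Real.rpow_natCast]
              ring
    _ = _ := by
        rw [lintegral_const_mul _ (by fun_prop), beta_lint (by positivity),
          ← ENNReal.ofReal_mul (by positivity), mul_assoc c]
        have : (m:ℝ) ≤ n := by exact_mod_cast hmn
        have : (0:ℝ) < N / p := by positivity
        linarith

lemma exp_int {p : ℝ} (hp : 0 < p) : IntegrableOn (fun t : ℝ => Real.exp (-(t ^ p))) (Ioi 1) := by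
  have := (dens_integrableOn hp (β := 0) (by norm_num)).mono_set (Ioi_subset_Ioi (zero_le_one' ℝ))
  refine this.congr_fun (fun t _ => ?_) measurableSet_Ioi
  simp [dens]

lemma tail_int {p : ℝ} (hp : 0 < p) {n m : ℕ} (hm : 1 ≤ m) (hn : 2 ≤ n) :
    ∫⁻ t in Ioi (1:ℝ), (Measure.pi fun _ : Fin n => gmeasure p (p / n - 1))
      {ω | ∃ S : Finset (Fin n), m ≤ S.card ∧ ∀ j ∈ S, ω j ∈ {x | t < |x|}} ≤
    ENNReal.ofReal ((n.choose m : ℝ) * (Real.exp (-1) / Real.Gamma (1 / n)) ^ m *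
      (Real.exp 1 * ∫ t in Ioi (1:ℝ), Real.exp (-(t ^ p)))) := by
  classical
  have := gmeasure_prob hp hn
  set ν := gmeasure p (p / n - 1) with hν
  have hG := Real.Gamma_pos_of_pos (show (0 : ℝ) < 1 / n by positivity)
  set G := Real.Gamma (1 / (n:ℝ))
  set D := (n.choose m : ℝ) * (Real.exp (-1) / G) ^ m * Real.exp 1 with hD
  have hD0 : 0 ≤ D := by positivity
  have hstep : ∀ t ∈ Ioi (1:ℝ), (Measure.pi fun _ : Fin n => ν)
      {ω | ∃ S : Finset (Fin n), m ≤ S.card ∧ ∀ j ∈ S, ω j ∈ {x | t < |x|}} ≤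
      ENNReal.ofReal (D * Real.exp (-(t ^ p))) := by
    intro t ht
    set A : Set ℝ := {x | t < |x|} with hA
    have hsub : {ω : Fin n → ℝ | ∃ S : Finset (Fin n), m ≤ S.card ∧ ∀ j ∈ S, ω j ∈ A} ⊆
        ⋃ S ∈ Finset.powersetCard m (Finset.univ : Finset (Fin n)),
          univ.pi (fun j => if j ∈ S then A else univ) := by
      rintro ω ⟨S, hS, h⟩
      obtain ⟨S', hS', hc⟩ := Finset.exists_subset_card_eq hS
      simp only [mem_iUnion]
      refine ⟨S', by simp [Finset.mem_powersetCard, hc], ?_⟩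
      intro j _
      by_cases hj : j ∈ S'
      · simpa [hj] using h j (hS' hj)
      · simp [hj]
    have hbox : ∀ S ∈ Finset.powersetCard m (Finset.univ : Finset (Fin n)),
        (Measure.pi fun _ : Fin n => ν) (univ.pi (fun j => if j ∈ S then A else univ)) = ν A ^ m := by
      intro S hS
      rw [Measure.pi_pi]
      have : ∀ j, ν (if j ∈ S then A else univ) = if j ∈ S then ν A else 1 := by
        intro j
        split_ifs
        · rfl
        · exact measure_univ
      simp_rw [this]
      rw [Finset.prod_ite_mem, Finset.univ_inter, Finset.prod_const, (Finset.mem_powersetCard.1 hS).2]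
    have ht1 : 1 ≤ t ^ p := Real.one_le_rpow (le_of_lt ht) hp.le
    have hm1 : (1:ℝ) ≤ m := by exact_mod_cast hm
    calc _ ≤ _ := measure_mono hsub
      _ ≤ _ := measure_biUnion_finset_le _ _
      _ = ∑ S ∈ Finset.powersetCard m (Finset.univ : Finset (Fin n)), ν A ^ m :=
        Finset.sum_congr rfl hbox
      _ = (n.choose m : ℝ≥0∞) * ν A ^ m := by simp
      _ ≤ (n.choose m : ℝ≥0∞) * (ENNReal.ofReal (Real.exp (-(t ^ p)) / G)) ^ m := by
        gcongr
        exact q_tail hp hn (le_of_lt ht)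
      _ = ENNReal.ofReal ((n.choose m : ℝ) * (Real.exp (-(t ^ p)) / G) ^ m) := by
        rw [ENNReal.ofReal_mul (by positivity), ENNReal.ofReal_pow (by positivity),
          ENNReal.ofReal_natCast]
      _ ≤ _ := by
        apply ENNReal.ofReal_le_ofReal
        rw [hD, div_pow, div_pow, ← Real.exp_nat_mul, ← Real.exp_nat_mul]
        have : Real.exp (m * -(t ^ p)) ≤ Real.exp (m * -1) * Real.exp 1 * Real.exp (-(t ^ p)) := by
          rw [← Real.exp_add, ← Real.exp_add]
          apply Real.exp_le_exp.2
          nlinarith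
        calc _ ≤ (n.choose m : ℝ) *
              (Real.exp (m * -1) * Real.exp 1 * Real.exp (-(t ^ p)) / G ^ m) := by gcongr
          _ = _ := by ring
  refine (setLIntegral_mono' measurableSet_Ioi hstep).trans_eq ?_
  rw [← ofReal_integral_eq_lintegral_ofReal ((exp_int hp).const_mul _), integral_const_mul, hD]
  · congr 1; ring
  · filter_upwards with t
    positivity

lemma kth_lint {p : ℝ} (hp : 0 < p) {n m : ℕ} (hmn : m ≤ n) (hn : 1 ≤ n) :
    ∫⁻ ω, ENNReal.ofReal (kthMax ω (m + 1))
      ∂(Measure.pi fun _ : Fin (n + 1) => gmeasure p (p / (n + 1 : ℕ) - 1)) ≤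
    ENNReal.ofReal (Real.exp (1 / p) * (((n + 1 : ℕ) : ℝ) * (n.choose m) *
      ProbabilityTheory.beta (m + 1) (n - m + (n + 1 : ℕ) / p + 1)) +
      ((n + 1).choose (m + 1) : ℝ) * (Real.exp (-1) / Real.Gamma (1 / (n + 1 : ℕ))) ^ (m + 1) *
      (Real.exp 1 * ∫ t in Ioi (1:ℝ), Real.exp (-(t ^ p)))) := by
  have hM : 1 ≤ m + 1 := by omega
  have hMN : m + 1 ≤ n + 1 := by omega
  rw [lintegral_eq_lintegral_meas_lt _ (Filter.Eventually.of_forall fun ω => kthMax_nonneg ω hM hMN)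
    (measurable_kthMax hM hMN).aemeasurable]
  simp_rw [lt_kthMax_iff _ hM hMN]
  rw [← Ioc_union_Ioi_eq_Ioi (zero_le_one' ℝ),
    lintegral_union measurableSet_Ioi (Ioc_disjoint_Ioi le_rfl)]
  have h1 := head_int hp hmn hn
  have h2 := tail_int hp hM (n := n + 1) (by omega)
  refine (add_le_add h1 h2).trans_eq ?_
  have hG := Real.Gamma_pos_of_pos (show (0 : ℝ) < 1 / (n + 1 : ℕ) by positivity)
  have hK : 0 ≤ ∫ t in Ioi (1:ℝ), Real.exp (-(t ^ p)) :=
    integral_nonneg fun t => (Real.exp_pos _).le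
  have hmn' : (m:ℝ) ≤ n := by exact_mod_cast hmn
  have hNp : (0:ℝ) < (n + 1 : ℕ) / p := by positivity
  have hb := ProbabilityTheory.beta_pos (α := m + 1) (β := n - m + (n + 1 : ℕ) / p + 1)
    (by positivity) (by linarith)
  rw [← ENNReal.ofReal_add (by positivity) (by positivity)]

lemma width_le {p : ℝ} (hp : 0 < p) {n m : ℕ} (hm : 1 ≤ m) (hmn : m ≤ n) (hn : 2 ≤ n) {B : ℝ}
    (hB : 0 ≤ B)
    (h : ∫⁻ ω, ENNReal.ofReal (kthMax ω m)
      ∂(Measure.pi fun _ : Fin n => gmeasure p (p / n - 1)) ≤ ENNReal.ofReal B) :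
    ∫ x, kthMax x m ∂(thetaMeasure p (p / n - 1) n) ≤ 2 * 5 ^ (1 / p) * B := by
  have := gmeasure_prob hp hn
  set ν := gmeasure p (p / n - 1) with hν
  have hn0 : (0:ℝ) < n := by positivity
  have hp1 : 0 < 1 / p := by positivity
  have hT : Measurable (fun (ω : Fin n → ℝ) i => ω i / (∑ j, |ω j| ^ p) ^ (1 / p)) := by
    fun_prop
  set F : (Fin n → ℝ) → ℝ := fun ω => kthMax (fun i => ω i / (∑ j, |ω j| ^ p) ^ (1 / p)) m with hF
  have hFm : Measurable F := (measurable_kthMax hm hmn).comp hT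
  have hF0 : ∀ ω, 0 ≤ F ω := fun ω => kthMax_nonneg _ hm hmn
  have hS0 : ∀ ω : Fin n → ℝ, 0 ≤ ∑ j, |ω j| ^ p := fun ω =>
    Finset.sum_nonneg fun j _ => Real.rpow_nonneg (abs_nonneg _) _
  have hF1 : ∀ ω, F ω ≤ 1 := by
    intro ω
    refine kthMax_le _ hm hmn fun j => ?_
    rw [abs_div, abs_of_nonneg (Real.rpow_nonneg (hS0 ω) _)]
    refine div_le_one_of_le₀ ?_ (Real.rpow_nonneg (hS0 ω) _)
    calc |ω j| = (|ω j| ^ p) ^ (1 / p) := by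
          rw [← Real.rpow_mul (abs_nonneg _), mul_one_div_cancel hp.ne', Real.rpow_one]
      _ ≤ _ := by
          refine Real.rpow_le_rpow (Real.rpow_nonneg (abs_nonneg _) _) ?_ hp1.le
          exact Finset.single_le_sum (f := fun j => |ω j| ^ p)
            (fun i _ => Real.rpow_nonneg (abs_nonneg _) _) (Finset.mem_univ j)
  have hFS : ∀ ω, F ω * (∑ j, |ω j| ^ p) ^ (1 / p) ≤ kthMax ω m := by
    intro ω
    rcases (hS0 ω).eq_or_lt with h0 | h0
    · rw [← h0, Real.zero_rpow hp1.ne', mul_zero]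
      exact kthMax_nonneg _ hm hmn
    · exact (kthMax_smul ω hm hmn (Real.rpow_pos_of_pos h0 _)).le
  set c : ℝ := (6:ℝ)⁻¹ ^ (1 / p) with hc
  have hc0 : 0 < c := by positivity
  have hcp : c ^ p = 6⁻¹ := by
    rw [hc, ← Real.rpow_mul (by norm_num), one_div_mul_cancel hp.ne', Real.rpow_one]
  have hFc : ∀ ω, F (fun i => c * ω i) = F ω := by
    intro ω
    simp only [hF]
    congr 1
    ext i
    have : ∑ j, |c * ω j| ^ p = c ^ p * ∑ j, |ω j| ^ p := by
      rw [Finset.mul_sum]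
      refine Finset.sum_congr rfl fun j _ => ?_
      rw [abs_mul, abs_of_pos hc0, Real.mul_rpow hc0.le (abs_nonneg _)]
    rw [this, Real.mul_rpow (by positivity) (hS0 ω), ← Real.rpow_mul hc0.le,
      mul_one_div_cancel hp.ne', Real.rpow_one, mul_div_mul_left _ _ hc0.ne']
  set μ := (Measure.pi fun _ : Fin n => ν) with hμ
  set f : ℝ → ℝ≥0∞ := fun t => ENNReal.ofReal (Real.exp (-(5 * |t| ^ p))) with hf
  have hfm : Measurable f := by fun_prop
  have hsc := pi_scale (n := n) ν f hfm (by
      intro t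
      rw [hf]
      simp only [ENNReal.ofReal_le_one, Real.exp_le_one_iff]
      have := Real.rpow_nonneg (abs_nonneg t) p
      linarith) (ENNReal.ofReal (c ^ (p / n - 1 + 1))) c (by
      intro s hs
      exact nu_scale hc0 (by rw [hcp]; norm_num) hs (Z_pos hp hn))
    (fun ω => ENNReal.ofReal (F ω)) hFm.ennreal_ofReal
  simp only [hFc] at hsc
  have ha : ENNReal.ofReal (c ^ (p / n - 1 + 1)) ^ n = ENNReal.ofReal 6⁻¹ := by
    rw [← ENNReal.ofReal_pow (by positivity), sub_add_cancel, ← Real.rpow_natCast,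
      ← Real.rpow_mul hc0.le, div_mul_cancel₀ _ hn0.ne', hcp]
  rw [ha] at hsc
  have hpt : ∀ ω, ENNReal.ofReal (F ω) ≤
      ENNReal.ofReal (Real.exp 1) * ((∏ i, f (ω i)) * ENNReal.ofReal (F ω)) +
      ENNReal.ofReal (5 ^ (1 / p)) * ENNReal.ofReal (kthMax ω m) := by
    intro ω
    have hk := kthMax_nonneg ω hm hmn
    simp only [hf]
    rw [← ENNReal.ofReal_prod_of_nonneg (fun i _ => (Real.exp_pos _).le), ← Real.exp_sum,
      ← ENNReal.ofReal_mul (by positivity), ← ENNReal.ofReal_mul (by positivity),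
      ← ENNReal.ofReal_mul (by positivity),
      ← ENNReal.ofReal_add (by have := hF0 ω; positivity) (by positivity)]
    apply ENNReal.ofReal_le_ofReal
    rw [Finset.sum_neg_distrib, ← Finset.mul_sum, ← mul_assoc, ← Real.exp_add]
    set S := ∑ j, |ω j| ^ p with hS
    have hS0' : 0 ≤ S := hS0 ω
    rcases le_total (5 * S) 1 with h1 | h1
    · have : 1 ≤ Real.exp (1 + -(5 * S)) := Real.one_le_exp (by linarith)
      have h2 : F ω ≤ Real.exp (1 + -(5 * S)) * F ω := le_mul_of_one_le_left (hF0 ω) this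
      have h3 : 0 ≤ (5:ℝ) ^ (1 / p) * kthMax ω m := by positivity
      linarith
    · have h2 : 1 ≤ (5 * S) ^ (1 / p) := Real.one_le_rpow h1 hp1.le
      rw [Real.mul_rpow (by norm_num) hS0'] at h2
      have h3 : 0 ≤ Real.exp (1 + -(5 * S)) * F ω := by have := hF0 ω; positivity
      have h4 : F ω ≤ (5:ℝ) ^ (1 / p) * kthMax ω m :=
        calc F ω ≤ (5 ^ (1 / p) * S ^ (1 / p)) * F ω := le_mul_of_one_le_left (hF0 ω) h2
          _ = 5 ^ (1 / p) * (F ω * S ^ (1 / p)) := by ring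
          _ ≤ _ := by gcongr; exact hFS ω
      linarith
  set L := ∫⁻ ω, ENNReal.ofReal (F ω) ∂μ with hL
  have hLfin : L ≠ ⊤ := by
    refine ne_of_lt ?_
    calc L ≤ ∫⁻ ω, 1 ∂μ := lintegral_mono fun ω => by simpa using hF1 ω
      _ < ⊤ := by simp
  have hprod : Measurable (fun ω : Fin n → ℝ => ∏ i, f (ω i)) :=
    Finset.measurable_prod _ fun i _ => hfm.comp (measurable_pi_apply i)
  have hpF : Measurable (fun ω : Fin n → ℝ => (∏ i, f (ω i)) * ENNReal.ofReal (F ω)) :=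
    hprod.mul hFm.ennreal_ofReal
  have hmain : L ≤ ENNReal.ofReal (Real.exp 1) * (ENNReal.ofReal 6⁻¹ * L) +
      ENNReal.ofReal (5 ^ (1 / p)) * ENNReal.ofReal B := by
    calc L ≤ _ := lintegral_mono hpt
      _ = ENNReal.ofReal (Real.exp 1) * (ENNReal.ofReal 6⁻¹ * L) +
          ENNReal.ofReal (5 ^ (1 / p)) * ∫⁻ ω, ENNReal.ofReal (kthMax ω m) ∂μ := by
        rw [lintegral_add_left (hpF.const_mul _),
          lintegral_const_mul _ hpF,
          lintegral_const_mul _ (measurable_kthMax hm hmn).ennreal_ofReal]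
        rw [hsc]
      _ ≤ _ := by gcongr
  have hint : ∫ x, kthMax x m ∂(thetaMeasure p (p / n - 1) n) = L.toReal := by
    unfold thetaMeasure
    rw [integral_map hT.aemeasurable (measurable_kthMax hm hmn).aestronglyMeasurable,
      integral_eq_lintegral_of_nonneg_ae (Filter.Eventually.of_forall hF0)
        hFm.aestronglyMeasurable]
  rw [hint]
  have hl0 : 0 ≤ L.toReal := ENNReal.toReal_nonneg
  set l := L.toReal with hl
  have hLl : L = ENNReal.ofReal l := (ENNReal.ofReal_toReal hLfin).symm
  rw [hLl, ← ENNReal.ofReal_mul (by positivity), ← ENNReal.ofReal_mul (by positivity),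
    ← ENNReal.ofReal_mul (by positivity), ← ENNReal.ofReal_add (by positivity) (by positivity),
    ENNReal.ofReal_le_ofReal_iff (by positivity)] at hmain
  have he := Real.exp_one_lt_d9
  have : Real.exp 1 * (6⁻¹ * l) ≤ 3 * (6⁻¹ * l) := by gcongr; linarith
  linarith

/-- For `0 < p < ∞` there is `C_p^2 > 0` depending only on `p` such that for all `n ≥ 2` and
`1 ≤ m ≤ n`, `σ_{m-1}^{p,∞}(θ_{p,p/n-1}) ≤ C_p^2 (Γ(n+1)/Γ(n-m+1)) ·
{Γ(n/p+n-m+1)/Γ(n/p+n+1) + (1/m!)(e^{-1}/Γ(1/n))^m}`. -/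
theorem theta_width_upper (p : ℝ) (hp : 0 < p) :
    ∃ C : ℝ, 0 < C ∧ ∀ n m : ℕ, 2 ≤ n → 1 ≤ m → m ≤ n →
      ∫ x, kthMax x m ∂(thetaMeasure p (p / n - 1) n)
        ≤ C * (Real.Gamma ((n : ℝ) + 1) / Real.Gamma ((n : ℝ) - m + 1))
          * (Real.Gamma ((n : ℝ) / p + n - m + 1) / Real.Gamma ((n : ℝ) / p + n + 1)
              + (1 / (Nat.factorial m : ℝ))
                * (Real.exp (-1) / Real.Gamma (1 / (n : ℝ))) ^ m) := by
  set K := ∫ t in Ioi (1:ℝ), Real.exp (-(t ^ p)) with hK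
  have hK0 : 0 ≤ K := integral_nonneg fun t => (Real.exp_pos _).le
  refine ⟨2 * 5 ^ (1 / p) * (Real.exp (1 / p) + Real.exp 1 * K), by positivity, ?_⟩
  intro N M hN hM hMN
  obtain ⟨n, rfl⟩ : ∃ n, N = n + 1 := ⟨N - 1, by omega⟩
  obtain ⟨m, rfl⟩ : ∃ m, M = m + 1 := ⟨M - 1, by omega⟩
  have hmn : m ≤ n := by omega
  have h := kth_lint hp hmn (by omega)
  have hG := Real.Gamma_pos_of_pos (show (0 : ℝ) < 1 / (n + 1 : ℕ) by positivity)
  have hmn' : (m:ℝ) ≤ n := by exact_mod_cast hmn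
  have hNp : (0:ℝ) < (n + 1 : ℕ) / p := by positivity
  have hb := ProbabilityTheory.beta_pos (α := m + 1) (β := n - m + (n + 1 : ℕ) / p + 1)
    (by positivity) (by linarith)
  refine (width_le hp hM hMN hN (by positivity) h).trans ?_
  rw [← hK]
  have hG1 : Real.Gamma (((n + 1 : ℕ) : ℝ) + 1) = (n + 1).factorial := Real.Gamma_nat_eq_factorial _
  have hG2 : Real.Gamma (((n + 1 : ℕ) : ℝ) - (m + 1 : ℕ) + 1) = (n - m).factorial := by
    rw [← Real.Gamma_nat_eq_factorial, Nat.cast_sub hmn]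
    congr 1; push_cast; ring
  have hG3 : Real.Gamma ((m:ℝ) + 1) = m.factorial := Real.Gamma_nat_eq_factorial _
  set G := Real.Gamma (1 / ((n + 1 : ℕ) : ℝ)) with hGd
  have hA := Real.Gamma_pos_of_pos (show (0:ℝ) < (n - m + (n + 1 : ℕ) / p + 1) by linarith)
  have hB := Real.Gamma_pos_of_pos (show (0:ℝ) < ((n + 1 : ℕ) / p + (n + 1 : ℕ) + 1) by positivity)
  have e3 : ((n + 1 : ℕ) : ℝ) / p + (n + 1 : ℕ) - (m + 1 : ℕ) + 1 = n - m + (n + 1 : ℕ) / p + 1 := by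
    push_cast; ring
  have e4 : ((m:ℝ) + 1) + (n - m + (n + 1 : ℕ) / p + 1) = (n + 1 : ℕ) / p + (n + 1 : ℕ) + 1 := by
    push_cast; ring
  unfold ProbabilityTheory.beta
  rw [e4, e3, hG1, hG2, hG3]
  set A := Real.Gamma (n - m + (n + 1 : ℕ) / p + 1)
  set B := Real.Gamma ((n + 1 : ℕ) / p + (n + 1 : ℕ) + 1)
  set X := (Real.exp (-1) / G) ^ (m + 1) with hX
  have hX0 : 0 ≤ X := by positivity
  have hf1 : (0:ℝ) < (n - m).factorial := by positivity
  have hf2 : (0:ℝ) < (m + 1).factorial := by positivity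
  have hf3 : (0:ℝ) < m.factorial := by positivity
  have hc1 : ((n.choose m : ℕ) : ℝ) = n.factorial / (m.factorial * (n - m).factorial) :=
    Nat.cast_choose ℝ hmn
  have hc2 : (((n + 1).choose (m + 1) : ℕ) : ℝ) =
      (n + 1).factorial / ((m + 1).factorial * (n - m).factorial) := by
    rw [Nat.cast_choose ℝ hMN, Nat.add_sub_add_right]
  have hfn : (((n + 1).factorial : ℕ) : ℝ) = (n + 1 : ℕ) * n.factorial := by
    rw [Nat.factorial_succ]; push_cast; ring
  set R := (((n + 1).factorial : ℕ) : ℝ) / (n - m).factorial with hR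
  have hR0 : 0 ≤ R := by positivity
  have t1 : ((n + 1 : ℕ) : ℝ) * n.choose m * (m.factorial * A / B) = R * (A / B) := by
    rw [hR, hc1, hfn]; field_simp
  have t2 : (((n + 1).choose (m + 1) : ℕ) : ℝ) * X = R * (1 / (m + 1).factorial * X) := by
    rw [hR, hc2]; field_simp
  rw [t1, t2]
  set U := R * (A / B) with hU
  set V := R * (1 / (m + 1).factorial * X) with hV
  have hU0 : 0 ≤ U := by positivity
  have hV0 : 0 ≤ V := by positivity
  have hfin : Real.exp (1 / p) * U + V * (Real.exp 1 * K) ≤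
      (Real.exp (1 / p) + Real.exp 1 * K) * (U + V) := by
    have : 0 ≤ Real.exp (1 / p) * V := by positivity
    have : 0 ≤ Real.exp 1 * K * U := by positivity
    nlinarith
  calc _ ≤ 2 * 5 ^ (1 / p) * ((Real.exp (1 / p) + Real.exp 1 * K) * (U + V)) := by gcongr
    _ = _ := by rw [hU, hV]; ring

end
end
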